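/- (Carleman estimate with divergence term.) There exist a sufficiently small r₁ > 0 and a sufficiently large β₁ > 3, both depending only on n, and a constant C depending only on n, such that for every scalar w ∈ C₀^∞(ℝⁿ∖{0}) with supp(w) ⊆ B_{r₁}, every vector field f = (f₁,…,fₙ) with each fⱼ ∈ C₀^∞(ℝⁿ∖{0}) and supp(fⱼ) ⊆ B_{r₁}, and every β ≥ β₁: ∫ φ_β² (log|x|)² (|x|^{4−n}|∇w|² + |x|^{2−n}|w|²) dx ≤ C ∫ φ_β² (log|x|)⁴ |x|^{2−n} [ (|x|² Δw + |x| div f)² + β ‖f‖² ] dx. -/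

import Mathlib

open MeasureTheory Real Set

noncomputable section

/-- The `j`-th partial derivative `∂_j f` of a scalar function on `ℝⁿ`. -/
def pdir (n : ℕ) (j : Fin n) (f : EuclideanSpace ℝ (Fin n) → ℝ) :
    EuclideanSpace ℝ (Fin n) → ℝ :=
  fun x => fderiv ℝ f x (EuclideanSpace.single j 1)

/-- The Laplacian `Δf = Σⱼ ∂ⱼ∂ⱼ f` of a scalar function on `ℝⁿ`. -/
def lapl (n : ℕ) (f : EuclideanSpace ℝ (Fin n) → ℝ)
    (x : EuclideanSpace ℝ (Fin n)) : ℝ :=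
  ∑ j, pdir n j (pdir n j f) x

/-- The radial Carleman weight `φ_β(r) = exp(-β ψ(log r))` with
`ψ(t) = t + log t²`, i.e. `φ_β(r) = r^{-β} (log r)^{-2β}` for `0 < r < 1`. -/
def carlemanWt (β r : ℝ) : ℝ :=
  Real.exp (-β * (Real.log r + Real.log ((Real.log r) ^ 2)))

section Helpers

/-- punctured ball in logarithmic form -/
def UT (n : ℕ) (T : ℝ) : Set (EuclideanSpace ℝ (Fin n)) := {x | x ≠ 0 ∧ Real.log ‖x‖ < T}

/-- test functions on the punctured ball -/
structure Adm (n : ℕ) (T : ℝ) (v : EuclideanSpace ℝ (Fin n) → ℝ) : Prop where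
  smooth : ContDiff ℝ (⊤ : ℕ∞) v
  cpt : HasCompactSupport v
  supp : tsupport v ⊆ UT n T

variable {n : ℕ} {T : ℝ}

lemma log_norm_continuousAt {x : EuclideanSpace ℝ (Fin n)} (hx : x ≠ 0) :
    ContinuousAt (fun y : EuclideanSpace ℝ (Fin n) => Real.log ‖y‖) x :=
  continuous_norm.continuousAt.log (norm_ne_zero_iff.2 hx)

lemma log_norm_contDiffAt {x : EuclideanSpace ℝ (Fin n)} (hx : x ≠ 0) {k : WithTop ℕ∞} :
    ContDiffAt ℝ k (fun y : EuclideanSpace ℝ (Fin n) => Real.log ‖y‖) x :=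
  (contDiffAt_norm ℝ hx).log (norm_ne_zero_iff.2 hx)

lemma log_norm_hasFDerivAt {x : EuclideanSpace ℝ (Fin n)} (hx : x ≠ 0) :
    HasFDerivAt (fun y : EuclideanSpace ℝ (Fin n) => Real.log ‖y‖)
      ((‖x‖ ^ 2)⁻¹ • innerSL ℝ x) x := by
  have h1 : HasFDerivAt (fun y : EuclideanSpace ℝ (Fin n) => ‖y‖ ^ 2) (2 • innerSL ℝ x) x :=
    (hasStrictFDerivAt_norm_sq x).hasFDerivAt
  have h0 : ‖x‖ ^ 2 ≠ 0 := by positivity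
  have h2 := (h1.log h0).const_mul (1/2)
  have : (fun y : EuclideanSpace ℝ (Fin n) => Real.log ‖y‖) =
      fun y => (1/2) * Real.log (‖y‖^2) := by
    funext y; rw [Real.log_pow]; push_cast; ring
  rw [this]
  have h3 : (‖x‖ ^ 2)⁻¹ • innerSL ℝ x = (1 / 2 : ℝ) • (‖x‖ ^ 2)⁻¹ • 2 • innerSL ℝ x := by
    ext y
    simp
    ring
  rw [h3]
  exact h2

lemma isOpen_UT : IsOpen (UT n T) := by
  rw [isOpen_iff_mem_nhds]
  rintro x ⟨hx, hT⟩
  have h1 : ∀ᶠ y in nhds x, y ≠ 0 := isOpen_ne.mem_nhds hx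
  have h2 : ∀ᶠ y : EuclideanSpace ℝ (Fin n) in nhds x, Real.log ‖y‖ < T :=
    (log_norm_continuousAt hx).eventually (gt_mem_nhds hT)
  filter_upwards [h1, h2] with y a b using ⟨a, b⟩

lemma radial_hasFDerivAt {g g' : ℝ → ℝ} {x : EuclideanSpace ℝ (Fin n)} (hx : x ≠ 0)
    (hg : HasDerivAt g (g' (Real.log ‖x‖)) (Real.log ‖x‖)) :
    HasFDerivAt (fun y : EuclideanSpace ℝ (Fin n) => g (Real.log ‖y‖))
      (g' (Real.log ‖x‖) • ((‖x‖ ^ 2)⁻¹ • innerSL ℝ x)) x :=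
  hg.comp_hasFDerivAt x (log_norm_hasFDerivAt hx)

lemma inner_single' (x : EuclideanSpace ℝ (Fin n)) (j : Fin n) :
    inner ℝ x (EuclideanSpace.single j (1:ℝ)) = x j := by
  simp [EuclideanSpace.inner_single_right]

lemma radial_pdir {g g' : ℝ → ℝ} {x : EuclideanSpace ℝ (Fin n)} (hx : x ≠ 0)
    (hg : HasDerivAt g (g' (Real.log ‖x‖)) (Real.log ‖x‖)) (j : Fin n) :
    pdir n j (fun y : EuclideanSpace ℝ (Fin n) => g (Real.log ‖y‖)) x =
      g' (Real.log ‖x‖) * x j / ‖x‖ ^ 2 := by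
  rw [pdir, (radial_hasFDerivAt hx hg).fderiv]
  simp [inner_single']
  ring

lemma fderiv_apply_sum (L : EuclideanSpace ℝ (Fin n) →L[ℝ] ℝ) (y : EuclideanSpace ℝ (Fin n)) :
    L y = ∑ j, y j * L (EuclideanSpace.single j 1) := by
  have : y = ∑ j, y j • EuclideanSpace.single j (1:ℝ) := by
    ext i; simp [Finset.sum_apply, Pi.single_apply]
  conv_lhs => rw [this]
  simp [map_sum]

lemma fderiv_norm_sq_le (w : EuclideanSpace ℝ (Fin n) → ℝ) (x : EuclideanSpace ℝ (Fin n)) :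
    ‖fderiv ℝ w x‖ ^ 2 ≤ ∑ j, (pdir n j w x) ^ 2 := by
  have h0 : 0 ≤ ∑ j, (pdir n j w x) ^ 2 := Finset.sum_nonneg fun _ _ => sq_nonneg _
  have : ‖fderiv ℝ w x‖ ≤ Real.sqrt (∑ j, (pdir n j w x) ^ 2) := by
    refine ContinuousLinearMap.opNorm_le_bound _ (Real.sqrt_nonneg _) fun y => ?_
    rw [fderiv_apply_sum (fderiv ℝ w x) y, EuclideanSpace.norm_eq, ← Real.sqrt_mul h0,
      Real.norm_eq_abs]
    refine Real.abs_le_sqrt ?_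
    have := Finset.sum_mul_sq_le_sq_mul_sq Finset.univ (fun j => pdir n j w x) (fun j => y j)
    simp only [Real.norm_eq_abs, sq_abs]
    refine le_trans (le_of_eq ?_) this
    congr 1
    refine Finset.sum_congr rfl fun j _ => ?_
    simp [pdir]; ring
  calc _ ≤ (Real.sqrt (∑ j, (pdir n j w x) ^ 2)) ^ 2 := by gcongr
    _ = _ := Real.sq_sqrt h0

lemma norm_sq_eq_sum (x : EuclideanSpace ℝ (Fin n)) : ‖x‖ ^ 2 = ∑ j, x j ^ 2 := by
  rw [EuclideanSpace.norm_sq_eq]; simp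

lemma integrable_mul_of {G h : EuclideanSpace ℝ (Fin n) → ℝ} (hG : ContinuousOn G (UT n T))
    (hh : Continuous h) (hc : HasCompactSupport h) (hs : tsupport h ⊆ UT n T) :
    Integrable (fun x => G x * h x) := by
  have hsub : tsupport (fun x => G x * h x) ⊆ tsupport h := tsupport_mul_subset_right
  refine Continuous.integrable_of_hasCompactSupport ?_ (hc.mul_left)
  refine continuous_of_tsupport fun x hx => ?_
  exact (hG.continuousAt (isOpen_UT.mem_nhds (hs (hsub hx)))).mul hh.continuousAt

lemma radial_continuousOn {g : ℝ → ℝ} (hg : ContinuousOn g (Iio T)) :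
    ContinuousOn (fun x : EuclideanSpace ℝ (Fin n) => g (Real.log ‖x‖)) (UT n T) := by
  intro x hx
  refine ContinuousAt.continuousWithinAt ?_
  exact ContinuousAt.comp (f := fun y : EuclideanSpace ℝ (Fin n) => Real.log ‖y‖)
    (hg.continuousAt (Iio_mem_nhds hx.2)) (log_norm_continuousAt hx.1)

lemma pdir_smooth {v : EuclideanSpace ℝ (Fin n) → ℝ} (hv : ContDiff ℝ (⊤ : ℕ∞) v) (j : Fin n) :
    ContDiff ℝ (⊤ : ℕ∞) (pdir n j v) := by
  have : ContDiff ℝ (⊤ : ℕ∞) (fderiv ℝ v) := hv.fderiv_right (by norm_cast)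
  exact this.clm_apply contDiff_const

lemma tsupport_pdir (v : EuclideanSpace ℝ (Fin n) → ℝ) (j : Fin n) :
    tsupport (pdir n j v) ⊆ tsupport v := tsupport_fderiv_apply_subset ℝ _

lemma Adm.pdir {v : EuclideanSpace ℝ (Fin n) → ℝ} (hv : Adm n T v) (j : Fin n) :
    Adm n T (pdir n j v) :=
  ⟨pdir_smooth hv.smooth j, hv.cpt.of_isClosed_subset (isClosed_tsupport _) (tsupport_pdir v j),
    (tsupport_pdir v j).trans hv.supp⟩

lemma contDiff_of_tsupp {v : EuclideanSpace ℝ (Fin n) → ℝ}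
    (h : ∀ x ∈ tsupport v, ContDiffAt ℝ (⊤ : ℕ∞) v x) : ContDiff ℝ (⊤ : ℕ∞) v := by
  rw [contDiff_iff_contDiffAt]
  intro x
  by_cases hx : x ∈ tsupport v
  · exact h x hx
  · exact (contDiffAt_const (c := (0:ℝ))).congr_of_eventuallyEq
      (notMem_tsupport_iff_eventuallyEq.1 hx)

lemma Adm.mul_contDiffAt {v G : EuclideanSpace ℝ (Fin n) → ℝ} (hv : Adm n T v)
    (hG : ∀ x ∈ UT n T, ContDiffAt ℝ (⊤ : ℕ∞) G x) : Adm n T (fun x => G x * v x) := by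
  have hsub : tsupport (fun x => G x * v x) ⊆ tsupport v := tsupport_mul_subset_right
  exact ⟨contDiff_of_tsupp fun x hx => (hG x (hv.supp (hsub hx))).mul hv.smooth.contDiffAt,
    hv.cpt.mul_left, hsub.trans hv.supp⟩

lemma Adm.mul_smooth {v G : EuclideanSpace ℝ (Fin n) → ℝ} (hv : Adm n T v)
    (hG : ContDiff ℝ (⊤ : ℕ∞) G) : Adm n T (fun x => G x * v x) :=
  hv.mul_contDiffAt fun _ _ => hG.contDiffAt

lemma Adm.zero : Adm n T (fun _ => 0) :=
  ⟨contDiff_const, HasCompactSupport.zero, by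
    have : tsupport (fun _ : EuclideanSpace ℝ (Fin n) => (0:ℝ)) = ∅ := by
      rw [tsupport_eq_empty_iff]; rfl
    rw [this]; exact empty_subset _⟩

lemma Adm.add {v w : EuclideanSpace ℝ (Fin n) → ℝ} (hv : Adm n T v) (hw : Adm n T w) :
    Adm n T (fun x => v x + w x) :=
  ⟨hv.smooth.add hw.smooth, hv.cpt.add hw.cpt, (tsupport_add v w).trans
    (union_subset hv.supp hw.supp)⟩

lemma Adm.const_mul {v : EuclideanSpace ℝ (Fin n) → ℝ} (hv : Adm n T v) (c : ℝ) :
    Adm n T (fun x => c * v x) := hv.mul_smooth contDiff_const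

lemma Adm.sub {v w : EuclideanSpace ℝ (Fin n) → ℝ} (hv : Adm n T v) (hw : Adm n T w) :
    Adm n T (fun x => v x - w x) := by
  have := hv.add (hw.const_mul (-1))
  convert this using 2; ring

lemma Adm.mul {v w : EuclideanSpace ℝ (Fin n) → ℝ} (hv : Adm n T v) (hw : Adm n T w) :
    Adm n T (fun x => v x * w x) := hw.mul_smooth hv.smooth

lemma Adm.sum {ι : Type*} (s : Finset ι) {v : ι → EuclideanSpace ℝ (Fin n) → ℝ}
    (hv : ∀ i ∈ s, Adm n T (v i)) : Adm n T (fun x => ∑ i ∈ s, v i x) := by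
  classical
  induction s using Finset.induction_on with
  | empty => simpa using Adm.zero
  | insert a s ha ih =>
    simp only [Finset.sum_insert ha]
    exact (hv a (by simp)).add (ih fun i hi => hv i (by simp [hi]))

lemma Adm.mono {T' : ℝ} (h : T ≤ T') {v : EuclideanSpace ℝ (Fin n) → ℝ} (hv : Adm n T v) :
    Adm n T' v := ⟨hv.smooth, hv.cpt, fun x hx => ⟨(hv.supp hx).1, (hv.supp hx).2.trans_le h⟩⟩

lemma coord_smooth (j : Fin n) :
    ContDiff ℝ (⊤ : ℕ∞) (fun x : EuclideanSpace ℝ (Fin n) => x j) := by fun_prop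

lemma Adm.integrable {v : EuclideanSpace ℝ (Fin n) → ℝ} (hv : Adm n T v) {g : ℝ → ℝ}
    (hg : ContinuousOn g (Iio T)) : Integrable (fun x => g (Real.log ‖x‖) * v x) :=
  integrable_mul_of (radial_continuousOn hg) hv.smooth.continuous hv.cpt hv.supp

lemma Adm.eq_zero {v : EuclideanSpace ℝ (Fin n) → ℝ} (hv : Adm n T v)
    {x : EuclideanSpace ℝ (Fin n)} (hx : x ∉ UT n T) : v x = 0 := by
  by_contra h
  exact hx (hv.supp (subset_tsupport _ h))

/-- radial divergence theorem -/
lemma div_radial {g g' : ℝ → ℝ} (hg : ∀ t < T, HasDerivAt g (g' t) t)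
    (hg' : ContinuousOn g' (Iio T)) {h : Fin n → EuclideanSpace ℝ (Fin n) → ℝ}
    (hh : ∀ j, Adm n T (h j)) :
    ∫ x : EuclideanSpace ℝ (Fin n), g (Real.log ‖x‖) * ∑ j, pdir n j (h j) x =
      - ∫ x : EuclideanSpace ℝ (Fin n),
        g' (Real.log ‖x‖) * ((∑ j, x j * h j x) / ‖x‖ ^ 2) := by
  have hgc : ContinuousOn g (Iio T) := fun t ht => (hg t ht).continuousAt.continuousWithinAt
  have hc2 : ContinuousOn (fun x : EuclideanSpace ℝ (Fin n) => g' (Real.log ‖x‖) * (‖x‖ ^ 2)⁻¹)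
      (UT n T) := by
    refine (radial_continuousOn hg').mul ?_
    intro x hx
    have : ‖x‖ ^ 2 ≠ 0 := by have := hx.1; positivity
    exact ContinuousAt.continuousWithinAt (by fun_prop (disch := assumption))
  have hI : ∀ j, Integrable (fun x : EuclideanSpace ℝ (Fin n) =>
      g' (Real.log ‖x‖) * x j / ‖x‖ ^ 2 * h j x) := by
    intro j
    have h3 := (hh j).mul_smooth (coord_smooth j)
    have := integrable_mul_of hc2 h3.smooth.continuous h3.cpt h3.supp
    refine this.congr (Filter.Eventually.of_forall fun x => ?_)
    simp only
    ring
  have key : ∀ j, ∫ x : EuclideanSpace ℝ (Fin n), g (Real.log ‖x‖) * pdir n j (h j) x =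
      - ∫ x : EuclideanSpace ℝ (Fin n), g' (Real.log ‖x‖) * x j / ‖x‖ ^ 2 * h j x := by
    intro j
    have hx0 : ∀ x ∈ tsupport (h j), HasFDerivAt
        (fun y : EuclideanSpace ℝ (Fin n) => g (Real.log ‖y‖))
        (g' (Real.log ‖x‖) • ((‖x‖ ^ 2)⁻¹ • innerSL ℝ x)) x := fun x hx =>
      radial_hasFDerivAt ((hh j).supp hx).1 (hg _ ((hh j).supp hx).2)
    have hd : ∀ x : EuclideanSpace ℝ (Fin n), (g' (Real.log ‖x‖) • ((‖x‖ ^ 2)⁻¹ • innerSL ℝ x))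
        (EuclideanSpace.single j (1:ℝ)) = g' (Real.log ‖x‖) * x j / ‖x‖ ^ 2 := by
      intro x
      simp [inner_single']
      ring
    have := integral_bilinear_hasFDerivAt_right_eq_neg_left_of_integrable
      (μ := (volume : Measure (EuclideanSpace ℝ (Fin n))))
      (f := fun y : EuclideanSpace ℝ (Fin n) => g (Real.log ‖y‖))
      (f' := fun x => g' (Real.log ‖x‖) • ((‖x‖ ^ 2)⁻¹ • innerSL ℝ x))
      (g := h j) (g' := fderiv ℝ (h j)) (v := EuclideanSpace.single j 1)
      (B := ContinuousLinearMap.mul ℝ ℝ) ?_ ?_ ?_ hx0 ?_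
    · simp only [ContinuousLinearMap.mul_apply', hd] at this; exact this
    · simpa only [ContinuousLinearMap.mul_apply', hd] using hI j
    · exact ((hh j).pdir j).integrable hgc
    · exact (hh j).integrable hgc
    · intro x _
      exact ((hh j).smooth.differentiable (by simp)).differentiableAt.hasFDerivAt
  simp only [Finset.mul_sum]
  rw [integral_finsetSum _ (fun j _ => ((hh j).pdir j).integrable hgc),
    Finset.sum_congr rfl fun j _ => key j, Finset.sum_neg_distrib,
    ← integral_finsetSum _ (fun j _ => hI j)]
  congr 1
  refine integral_congr_ae (Filter.Eventually.of_forall fun x => ?_)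
  simp only [Finset.sum_div, Finset.mul_sum]
  refine Finset.sum_congr rfl fun j _ => ?_
  ring

lemma pdir_mul {a c : EuclideanSpace ℝ (Fin n) → ℝ} {x : EuclideanSpace ℝ (Fin n)} (j : Fin n)
    (ha : DifferentiableAt ℝ a x) (hc : DifferentiableAt ℝ c x) :
    pdir n j (fun y => a y * c y) x = a x * pdir n j c x + pdir n j a x * c x := by
  have := fderiv_fun_mul ha hc
  simp only [pdir, this]
  simp
  ring

lemma pdir_add {a c : EuclideanSpace ℝ (Fin n) → ℝ} {x : EuclideanSpace ℝ (Fin n)} (j : Fin n)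
    (ha : DifferentiableAt ℝ a x) (hc : DifferentiableAt ℝ c x) :
    pdir n j (fun y => a y + c y) x = pdir n j a x + pdir n j c x := by
  have := fderiv_fun_add ha hc
  simp only [pdir, this]
  simp

lemma pdir_sub {a c : EuclideanSpace ℝ (Fin n) → ℝ} {x : EuclideanSpace ℝ (Fin n)} (j : Fin n)
    (ha : DifferentiableAt ℝ a x) (hc : DifferentiableAt ℝ c x) :
    pdir n j (fun y => a y - c y) x = pdir n j a x - pdir n j c x := by
  have := fderiv_fun_sub ha hc
  simp only [pdir, this]
  simp

lemma pdir_sum {ι : Type*} (s : Finset ι) {a : ι → EuclideanSpace ℝ (Fin n) → ℝ}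
    {x : EuclideanSpace ℝ (Fin n)} (j : Fin n)
    (ha : ∀ i ∈ s, DifferentiableAt ℝ (a i) x) :
    pdir n j (fun y => ∑ i ∈ s, a i y) x = ∑ i ∈ s, pdir n j (a i) x := by
  have := fderiv_fun_sum ha
  simp only [pdir, this]
  simp

lemma pdir_const_mul {a : EuclideanSpace ℝ (Fin n) → ℝ} {x : EuclideanSpace ℝ (Fin n)}
    (j : Fin n) (c : ℝ) (ha : DifferentiableAt ℝ a x) :
    pdir n j (fun y => c * a y) x = c * pdir n j a x := by
  simp only [pdir, fderiv_const_mul ha c]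
  simp

lemma pdir_coord (j k : Fin n) (x : EuclideanSpace ℝ (Fin n)) :
    pdir n j (fun y => y k) x = if j = k then 1 else 0 := by
  have : HasFDerivAt (fun y : EuclideanSpace ℝ (Fin n) => y k)
      (EuclideanSpace.proj k : EuclideanSpace ℝ (Fin n) →L[ℝ] ℝ) x :=
    (EuclideanSpace.proj k : EuclideanSpace ℝ (Fin n) →L[ℝ] ℝ).hasFDerivAt
  rw [pdir, this.fderiv]
  simp [eq_comm]

lemma pdir_congr {a c : EuclideanSpace ℝ (Fin n) → ℝ} {x : EuclideanSpace ℝ (Fin n)}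
    (j : Fin n) (h : a =ᶠ[nhds x] c) : pdir n j a x = pdir n j c x := by
  simp only [pdir, h.fderiv_eq]

lemma pdir_comm {v : EuclideanSpace ℝ (Fin n) → ℝ} (hv : ContDiff ℝ (⊤ : ℕ∞) v) (j k : Fin n)
    (x : EuclideanSpace ℝ (Fin n)) : pdir n j (pdir n k v) x = pdir n k (pdir n j v) x := by
  have hd : DifferentiableAt ℝ (fderiv ℝ v) x :=
    ((hv.fderiv_right (m := (⊤ : ℕ∞)) (by norm_cast)).differentiable (by simp)).differentiableAt
  have h1 : ∀ a c : Fin n, pdir n a (pdir n c v) x =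
      fderiv ℝ (fderiv ℝ v) x (EuclideanSpace.single a 1) (EuclideanSpace.single c 1) := by
    intro a c
    have h2 : pdir n c v = fun y => fderiv ℝ v y (EuclideanSpace.single c 1) := rfl
    rw [pdir, h2, fderiv_clm_apply hd (differentiableAt_const _)]
    simp
  rw [h1, h1]
  have : IsSymmSndFDerivAt ℝ v x := hv.contDiffAt.isSymmSndFDerivAt (by
    simp only [minSmoothness_of_isRCLikeNormedField]; exact WithTop.coe_le_coe.2 (le_top : (2:ℕ∞) ≤ ⊤))
  exact this.eq _ _

/-- Euler derivative -/
def Dop (n : ℕ) (v : EuclideanSpace ℝ (Fin n) → ℝ) (x : EuclideanSpace ℝ (Fin n)) : ℝ :=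
  ∑ j, x j * pdir n j v x

/-- squared gradient -/
def gsq (n : ℕ) (v : EuclideanSpace ℝ (Fin n) → ℝ) (x : EuclideanSpace ℝ (Fin n)) : ℝ :=
  ∑ j, (pdir n j v x) ^ 2

lemma Adm.diff {v : EuclideanSpace ℝ (Fin n) → ℝ} (hv : Adm n T v)
    (x : EuclideanSpace ℝ (Fin n)) : DifferentiableAt ℝ v x :=
  (hv.smooth.differentiable (by simp)).differentiableAt

lemma coord_diff (k : Fin n) (x : EuclideanSpace ℝ (Fin n)) :
    DifferentiableAt ℝ (fun y : EuclideanSpace ℝ (Fin n) => y k) x :=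
  ((coord_smooth k).differentiable (by simp)).differentiableAt

lemma Adm.dop {v : EuclideanSpace ℝ (Fin n) → ℝ} (hv : Adm n T v) : Adm n T (Dop n v) :=
  Adm.sum Finset.univ fun j _ => (hv.pdir j).mul_smooth (coord_smooth j)

lemma Adm.gsq {v : EuclideanSpace ℝ (Fin n) → ℝ} (hv : Adm n T v) : Adm n T (gsq n v) := by
  have := Adm.sum Finset.univ fun j _ => (hv.pdir j).mul (hv.pdir j)
  convert this using 2 with x
  simp [_root_.gsq, sq]

lemma Adm.lapl {v : EuclideanSpace ℝ (Fin n) → ℝ} (hv : Adm n T v) : Adm n T (lapl n v) :=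
  Adm.sum Finset.univ fun j _ => (hv.pdir j).pdir j

lemma sum_x_delta (j : Fin n) (a : Fin n → ℝ) : ∑ k, (if j = k then (1:ℝ) else 0) * a k = a j := by
  simp

lemma pdir_dop {v : EuclideanSpace ℝ (Fin n) → ℝ} (hv : Adm n T v) (j : Fin n)
    (x : EuclideanSpace ℝ (Fin n)) :
    pdir n j (Dop n v) x = pdir n j v x + ∑ k, x k * pdir n j (pdir n k v) x := by
  have : Dop n v = fun y => ∑ k, y k * pdir n k v y := rfl
  rw [this, pdir_sum Finset.univ j fun k _ => (coord_diff k x).fun_mul ((hv.pdir k).diff x)]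
  rw [Finset.sum_congr rfl fun k _ => pdir_mul j (coord_diff k x) ((hv.pdir k).diff x)]
  simp only [pdir_coord, Finset.sum_add_distrib, sum_x_delta]
  ring

lemma pdir_gsq {v : EuclideanSpace ℝ (Fin n) → ℝ} (hv : Adm n T v) (j : Fin n)
    (x : EuclideanSpace ℝ (Fin n)) :
    pdir n j (gsq n v) x = ∑ k, 2 * (pdir n k v x * pdir n j (pdir n k v) x) := by
  have : gsq n v = fun y => ∑ k, pdir n k v y * pdir n k v y := by
    funext y; simp [gsq, sq]
  rw [this, pdir_sum Finset.univ j fun k _ => ((hv.pdir k).diff x).fun_mul ((hv.pdir k).diff x)]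
  rw [Finset.sum_congr rfl fun k _ => pdir_mul j ((hv.pdir k).diff x) ((hv.pdir k).diff x)]
  refine Finset.sum_congr rfl fun k _ => ?_
  ring

/-- Pohozaev field -/
lemma div_A {v : EuclideanSpace ℝ (Fin n) → ℝ} (hv : Adm n T v) (x : EuclideanSpace ℝ (Fin n)) :
    ∑ j, pdir n j (fun y => 2 * (Dop n v y * pdir n j v y) - y j * gsq n v y) x =
      2 * lapl n v x * Dop n v x - (n - 2 : ℝ) * gsq n v x := by
  have h1 : ∀ j, pdir n j (fun y => 2 * (Dop n v y * pdir n j v y) - y j * gsq n v y) x =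
      2 * (pdir n j v x) ^ 2 + 2 * (∑ k, x k * pdir n j v x * pdir n j (pdir n k v) x)
      + 2 * Dop n v x * pdir n j (pdir n j v) x - gsq n v x
      - 2 * ∑ k, x j * pdir n k v x * pdir n j (pdir n k v) x := by
    intro j
    have e1 := (hv.dop.diff x)
    have e2 := ((hv.pdir j).diff x)
    rw [pdir_sub j ((e1.fun_mul e2).const_mul 2) ((coord_diff j x).fun_mul (hv.gsq.diff x)),
      pdir_const_mul j 2 (e1.fun_mul e2), pdir_mul j e1 e2, pdir_mul j (coord_diff j x) (hv.gsq.diff x),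
      pdir_dop hv, pdir_gsq hv, pdir_coord]
    have a1 : ∑ k, x k * pdir n j v x * pdir n j (pdir n k v) x =
        (∑ k, x k * pdir n j (pdir n k v) x) * pdir n j v x := by
      rw [Finset.sum_mul]; exact Finset.sum_congr rfl fun k _ => by ring
    have a2 : ∑ k, x j * pdir n k v x * pdir n j (pdir n k v) x =
        x j * ∑ k, (pdir n k v x * pdir n j (pdir n k v) x) := by
      rw [Finset.mul_sum]; exact Finset.sum_congr rfl fun k _ => by ring
    rw [a1, a2, ← Finset.mul_sum]
    simp
    ring
  have h2 : ∑ j, ∑ k, x j * pdir n k v x * pdir n j (pdir n k v) x =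
      ∑ j, ∑ k, x k * pdir n j v x * pdir n j (pdir n k v) x := by
    rw [Finset.sum_comm]
    refine Finset.sum_congr rfl fun j _ => Finset.sum_congr rfl fun k _ => ?_
    rw [pdir_comm hv.smooth]
  rw [Finset.sum_congr rfl fun j _ => h1 j]
  simp only [Finset.sum_sub_distrib, Finset.sum_add_distrib, ← Finset.mul_sum, h2]
  simp only [lapl, gsq, Finset.sum_const, Finset.card_univ, Fintype.card_fin, nsmul_eq_mul]
  ring

lemma div_B {v u : EuclideanSpace ℝ (Fin n) → ℝ} (hv : Adm n T v) (hu : Adm n T u)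
    (x : EuclideanSpace ℝ (Fin n)) :
    ∑ j, pdir n j (fun y => u y * pdir n j v y) x =
      u x * lapl n v x + ∑ j, pdir n j u x * pdir n j v x := by
  rw [Finset.sum_congr rfl fun j _ => pdir_mul j (hu.diff x) ((hv.pdir j).diff x)]
  rw [Finset.sum_add_distrib, lapl, Finset.mul_sum]

lemma div_C {v : EuclideanSpace ℝ (Fin n) → ℝ} (hv : Adm n T v) (x : EuclideanSpace ℝ (Fin n)) :
    ∑ j, pdir n j (fun y => y j * (v y * v y)) x =
      n * (v x) ^ 2 + 2 * v x * Dop n v x := by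
  rw [Finset.sum_congr rfl fun j _ => pdir_mul j (coord_diff j x) ((hv.diff x).fun_mul (hv.diff x))]
  rw [Finset.sum_congr rfl fun j _ => by rw [pdir_mul j (hv.diff x) (hv.diff x), pdir_coord]]
  simp only [Finset.sum_add_distrib, Dop, Finset.mul_sum, ite_true]
  simp
  rw [add_comm, sq]
  congr 1
  exact Finset.sum_congr rfl fun k _ => by ring

lemma lapl_radial_mul {p p1 p2 : ℝ → ℝ} (hp : ∀ t < T, HasDerivAt p (p1 t) t)
    (hp1 : ∀ t < T, HasDerivAt p1 (p2 t) t)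
    {v : EuclideanSpace ℝ (Fin n) → ℝ} (hv : Adm n T v) {x : EuclideanSpace ℝ (Fin n)}
    (hx : x ∈ UT n T) :
    ‖x‖ ^ 2 * lapl n (fun y => p (Real.log ‖y‖) * v y) x =
      p (Real.log ‖x‖) * (‖x‖ ^ 2 * lapl n v x) + 2 * p1 (Real.log ‖x‖) * Dop n v x
      + (p2 (Real.log ‖x‖) + (n - 2 : ℝ) * p1 (Real.log ‖x‖)) * v x := by
  have hexp : ∀ y ∈ UT n T, Real.exp (-2 * Real.log ‖y‖) = (‖y‖ ^ 2)⁻¹ := by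
    intro y hy
    have : 0 < ‖y‖ := norm_pos_iff.2 hy.1
    rw [neg_mul, Real.exp_neg, show 2 * Real.log ‖y‖ = Real.log ‖y‖ + Real.log ‖y‖ by ring,
      Real.exp_add, Real.exp_log this, sq]
  set k : ℝ → ℝ := fun t => p1 t * Real.exp (-2 * t) with hk
  have hk' : ∀ t < T, HasDerivAt k (p2 t * Real.exp (-2*t) + p1 t * (Real.exp (-2*t) * (-2))) t := by
    intro t ht
    have : HasDerivAt (fun t : ℝ => Real.exp (-2 * t)) (Real.exp (-2*t) * (-2)) t := by
      have := ((hasDerivAt_id t).const_mul (-2:ℝ)).exp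
      simpa using this
    exact (hp1 t ht).mul this
  have dr : ∀ {g g' : ℝ → ℝ}, (∀ t < T, HasDerivAt g (g' t) t) → ∀ y ∈ UT n T,
      DifferentiableAt ℝ (fun y : EuclideanSpace ℝ (Fin n) => g (Real.log ‖y‖)) y :=
    fun hg y hy => (radial_hasFDerivAt hy.1 (hg _ hy.2)).differentiableAt
  have f1 : ∀ j, ∀ y ∈ UT n T, pdir n j (fun y => p (Real.log ‖y‖) * v y) y =
      p (Real.log ‖y‖) * pdir n j v y + k (Real.log ‖y‖) * (y j * v y) := by
    intro j y hy
    rw [pdir_mul j (dr hp y hy) (hv.diff y), radial_pdir hy.1 (hp _ hy.2), hk]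
    simp only [hexp y hy]
    ring
  have f2 : ∀ j, pdir n j (pdir n j (fun y => p (Real.log ‖y‖) * v y)) x =
      p (Real.log ‖x‖) * pdir n j (pdir n j v) x
      + (2 * p1 (Real.log ‖x‖) * (x j * pdir n j v x)
        + (p2 (Real.log ‖x‖) - 2 * p1 (Real.log ‖x‖)) * v x * (x j ^ 2 / ‖x‖ ^ 2)
        + p1 (Real.log ‖x‖) * v x) / ‖x‖ ^ 2 := by
    intro j
    have hc : (pdir n j (fun y => p (Real.log ‖y‖) * v y)) =ᶠ[nhds x]
        fun y => p (Real.log ‖y‖) * pdir n j v y + k (Real.log ‖y‖) * (y j * v y) := by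
      filter_upwards [isOpen_UT.mem_nhds hx] with y hy using f1 j y hy
    have e1 := (hv.pdir j).diff x
    have e2 := (coord_diff j x).fun_mul (hv.diff x)
    rw [pdir_congr j hc, pdir_add j ((dr hp x hx).fun_mul e1) ((dr hk' x hx).fun_mul e2),
      pdir_mul j (dr hp x hx) e1, pdir_mul j (dr hk' x hx) e2,
      pdir_mul j (coord_diff j x) (hv.diff x), pdir_coord, radial_pdir hx.1 (hp _ hx.2),
      radial_pdir (g' := fun t => p2 t * Real.exp (-2*t) + p1 t * (Real.exp (-2*t) * (-2)))
        hx.1 (hk' _ hx.2), hk]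
    simp only [hexp x hx, if_true]
    ring
  have hr : ‖x‖ ^ 2 ≠ 0 := by have := hx.1; positivity
  rw [lapl, Finset.sum_congr rfl fun j _ => f2 j, Finset.sum_add_distrib, ← Finset.mul_sum,
    ← Finset.sum_div, Finset.sum_add_distrib, Finset.sum_add_distrib, ← Finset.mul_sum,
    ← Finset.mul_sum, ← Finset.sum_div, ← norm_sq_eq_sum, div_self hr]
  simp only [Finset.sum_const, Finset.card_univ, Fintype.card_fin, nsmul_eq_mul, lapl, Dop]
  have hr' : ‖x‖ ≠ 0 := norm_ne_zero_iff.2 hx.1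
  field_simp
  ring

lemma exp_log_norm {x : EuclideanSpace ℝ (Fin n)} (hx : x ≠ 0) (c : ℝ) :
    Real.exp ((2 + c) * Real.log ‖x‖) = ‖x‖ ^ 2 * Real.exp (c * Real.log ‖x‖) := by
  have : 0 < ‖x‖ := norm_pos_iff.2 hx
  rw [show (2 + c) * Real.log ‖x‖ = Real.log ‖x‖ + Real.log ‖x‖ + c * Real.log ‖x‖ by ring,
    Real.exp_add, Real.exp_add, Real.exp_log this, sq]

lemma hasDerivAt_expc (c t : ℝ) :
    HasDerivAt (fun t : ℝ => Real.exp (c * t)) (c * Real.exp (c * t)) t := by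
  have := ((hasDerivAt_id t).const_mul c).exp
  simpa [mul_comm] using this

lemma carleman_v {q q1 q2 q3 : ℝ → ℝ} (m : ℝ) (hm : (n : ℝ) = 2 * m + 2)
    (hq : ∀ t < T, HasDerivAt q (q1 t) t)
    (hq1 : ∀ t < T, HasDerivAt q1 (q2 t) t)
    (hq2 : ∀ t < T, HasDerivAt q2 (q3 t) t) (hq3 : ContinuousOn q3 (Iio T))
    (hneg : ∀ t < T, q1 t ≤ 0)
    {v : EuclideanSpace ℝ (Fin n) → ℝ} (hv : Adm n T v) :
    ∫ x : EuclideanSpace ℝ (Fin n), Real.exp (-n * Real.log ‖x‖) *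
      ((-4 * q (Real.log ‖x‖) ^ 2 * q1 (Real.log ‖x‖) + q3 (Real.log ‖x‖)) * v x ^ 2) ≤
    ∫ x : EuclideanSpace ℝ (Fin n), Real.exp (-n * Real.log ‖x‖) *
      (‖x‖ ^ 2 * lapl n v x - 2 * m * Dop n v x + (q (Real.log ‖x‖) ^ 2 - m ^ 2) * v x
        + (2 * q (Real.log ‖x‖) * Dop n v x + q1 (Real.log ‖x‖) * v x)) ^ 2 := by
  have cq : ContinuousOn q (Iio T) := fun t ht => (hq t ht).continuousAt.continuousWithinAt
  have cq1 : ContinuousOn q1 (Iio T) := fun t ht => (hq1 t ht).continuousAt.continuousWithinAt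
  have cq2 : ContinuousOn q2 (Iio T) := fun t ht => (hq2 t ht).continuousAt.continuousWithinAt
  -- weights
  set gA : ℝ → ℝ := fun t => 2 * q t * Real.exp (-(2 * m) * t) with hgA
  set gA' : ℝ → ℝ := fun t => 2 * q1 t * Real.exp (-(2 * m) * t)
    + 2 * q t * (-(2 * m) * Real.exp (-(2 * m) * t)) with hgA'
  set gB : ℝ → ℝ := fun t => 2 * q1 t * Real.exp (-(2 * m) * t) with hgB
  set gB' : ℝ → ℝ := fun t => 2 * q2 t * Real.exp (-(2 * m) * t)
    + 2 * q1 t * (-(2 * m) * Real.exp (-(2 * m) * t)) with hgB'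
  set gC : ℝ → ℝ := fun t => (2 * q t ^ 3 - 2 * m ^ 2 * q t - q2 t) * Real.exp (-n * t) with hgC
  set gC' : ℝ → ℝ := fun t => (2 * (3 * q t ^ 2 * q1 t) - 2 * m ^ 2 * q1 t - q3 t)
      * Real.exp (-n * t)
    + (2 * q t ^ 3 - 2 * m ^ 2 * q t - q2 t) * (-n * Real.exp (-n * t)) with hgC'
  have dA : ∀ t < T, HasDerivAt gA (gA' t) t := fun t ht =>
    ((hq t ht).const_mul 2).mul (hasDerivAt_expc _ t)
  have dB : ∀ t < T, HasDerivAt gB (gB' t) t := fun t ht =>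
    ((hq1 t ht).const_mul 2).mul (hasDerivAt_expc _ t)
  have dC : ∀ t < T, HasDerivAt gC (gC' t) t := fun t ht => by
    have h3 : HasDerivAt (fun t => q t ^ 3) (3 * q t ^ 2 * q1 t) t := by
      simpa using (hq t ht).fun_pow 3
    exact (((h3.const_mul 2).sub ((hq t ht).const_mul (2 * m ^ 2))).sub (hq2 t ht)).mul
      (hasDerivAt_expc _ t)
  have cA' : ContinuousOn gA' (Iio T) := by fun_prop
  have cB' : ContinuousOn gB' (Iio T) := by fun_prop
  have cC' : ContinuousOn gC' (Iio T) := by fun_prop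
  have cA : ContinuousOn gA (Iio T) := by fun_prop
  have cB : ContinuousOn gB (Iio T) := by fun_prop
  have cC : ContinuousOn gC (Iio T) := by fun_prop
  -- fields
  have aA : ∀ j, Adm n T (fun y => 2 * (Dop n v y * pdir n j v y) - y j * gsq n v y) := fun j =>
    ((hv.dop.mul (hv.pdir j)).const_mul 2).sub (hv.gsq.mul_smooth (coord_smooth j))
  have aB : ∀ j, Adm n T (fun y => v y * pdir n j v y) := fun j => hv.mul (hv.pdir j)
  have aC : ∀ j, Adm n T (fun y => y j * (v y * v y)) := fun j =>
    (hv.mul hv).mul_smooth (coord_smooth j)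
  have eA := div_radial dA cA' aA
  have eB := div_radial dB cB' aB
  have eC := div_radial dC cC' aC
  have sumI : ∀ {g : ℝ → ℝ} (_ : ContinuousOn g (Iio T))
      {h : Fin n → EuclideanSpace ℝ (Fin n) → ℝ} (_ : ∀ j, Adm n T (h j)),
      Integrable fun x : EuclideanSpace ℝ (Fin n) =>
        g (Real.log ‖x‖) * ∑ j, pdir n j (h j) x := fun hg _ ah =>
    (Adm.sum Finset.univ fun j _ => (ah j).pdir j).integrable hg
  have sumI' : ∀ {g : ℝ → ℝ} (_ : ContinuousOn g (Iio T))
      {h : Fin n → EuclideanSpace ℝ (Fin n) → ℝ} (_ : ∀ j, Adm n T (h j)),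
      Integrable fun x : EuclideanSpace ℝ (Fin n) =>
        g (Real.log ‖x‖) * ((∑ j, x j * h j x) / ‖x‖ ^ 2) := by
    intro g hg h ah
    have hadm : Adm n T (fun x : EuclideanSpace ℝ (Fin n) => ‖x‖⁻¹ ^ 2 * ∑ j, x j * h j x) := by
      refine (Adm.sum Finset.univ fun j _ => (ah j).mul_smooth (coord_smooth j)).mul_contDiffAt ?_
      intro x hx
      exact ((contDiffAt_norm ℝ hx.1).inv (norm_ne_zero_iff.2 hx.1)).pow 2
    refine (hadm.integrable hg).congr (Filter.Eventually.of_forall fun x => ?_)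
    simp only [inv_pow]
    ring
  have iA := sumI cA aA
  have iB := sumI cB aB
  have iC := sumI cC aC
  have iA' := sumI' cA' aA
  have iB' := sumI' cB' aB
  have iC' := sumI' cC' aC
  have hI := ((((iA.add iA').add iB).add iB').add iC).add iC'
  have cexp : ContinuousOn (fun t : ℝ => Real.exp (-n * t)) (Iio T) := by fun_prop
  have iL : Integrable fun x : EuclideanSpace ℝ (Fin n) => Real.exp (-n * Real.log ‖x‖) *
      ((-4 * q (Real.log ‖x‖) ^ 2 * q1 (Real.log ‖x‖) + q3 (Real.log ‖x‖)) * v x ^ 2) := by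
    have hc : ContinuousOn (fun t : ℝ => Real.exp (-n * t) * (-4 * q t ^ 2 * q1 t + q3 t))
      (Iio T) := by fun_prop
    refine ((hv.mul hv).integrable hc).congr (Filter.Eventually.of_forall fun x => ?_)
    simp only
    ring
  have iR : Integrable fun x : EuclideanSpace ℝ (Fin n) => Real.exp (-n * Real.log ‖x‖) *
      (‖x‖ ^ 2 * lapl n v x - 2 * m * Dop n v x + (q (Real.log ‖x‖) ^ 2 - m ^ 2) * v x
        + (2 * q (Real.log ‖x‖) * Dop n v x + q1 (Real.log ‖x‖) * v x)) ^ 2 := by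
    have hr : ContDiff ℝ (⊤ : ℕ∞) (fun x : EuclideanSpace ℝ (Fin n) => ‖x‖ ^ 2) :=
      contDiff_norm_sq ℝ
    set X : EuclideanSpace ℝ (Fin n) → ℝ := fun x => ‖x‖ ^ 2 * lapl n v x - 2 * m * Dop n v x
    have aX : Adm n T X := (hv.lapl.mul_smooth hr).sub (hv.dop.const_mul (2 * m))
    have c1 : ContinuousOn (fun t : ℝ => Real.exp (-n * t) * (2 * (q t ^ 2 - m ^ 2 + q1 t)))
      (Iio T) := by fun_prop
    have c2 : ContinuousOn (fun t : ℝ => Real.exp (-n * t) * (4 * q t))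
      (Iio T) := by fun_prop
    have c3 : ContinuousOn (fun t : ℝ => Real.exp (-n * t) * ((q t ^ 2 - m ^ 2 + q1 t) ^ 2))
      (Iio T) := by fun_prop
    have c4 : ContinuousOn (fun t : ℝ => Real.exp (-n * t) *
      (4 * q t * (q t ^ 2 - m ^ 2 + q1 t))) (Iio T) := by fun_prop
    have c5 : ContinuousOn (fun t : ℝ => Real.exp (-n * t) * (4 * q t ^ 2))
      (Iio T) := by fun_prop
    have := (((((aX.mul aX).integrable cexp).add ((aX.mul hv).integrable c1)).add
      ((aX.mul hv.dop).integrable c2)).add ((hv.mul hv).integrable c3)).add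
      ((hv.mul hv.dop).integrable c4) |>.add ((hv.dop.mul hv.dop).integrable c5)
    refine this.congr (Filter.Eventually.of_forall fun x => ?_)
    simp only [Pi.add_apply, X]
    ring
  have hle := integral_mono (iL.add hI) iR ?_
  · rw [integral_add' iL hI, integral_add' ((((iA.add iA').add iB).add iB').add iC) iC',
      integral_add' (((iA.add iA').add iB).add iB') iC,
      integral_add' ((iA.add iA').add iB) iB', integral_add' (iA.add iA') iB,
      integral_add' iA iA', eA, eB, eC] at hle
    linarith
  · intro x
    simp only [Pi.add_apply]
    by_cases hx : x ∈ UT n T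
    · rw [div_A hv, div_B hv hv, div_C hv]
      have s1 : ∑ j, x j * (2 * (Dop n v x * pdir n j v x) - x j * gsq n v x) =
          2 * Dop n v x ^ 2 - ‖x‖ ^ 2 * gsq n v x := by
        rw [norm_sq_eq_sum, Finset.sum_mul, sq, Dop, ← mul_assoc, Finset.mul_sum,
          ← Finset.sum_sub_distrib]
        exact Finset.sum_congr rfl fun j _ => by ring
      have s2 : ∑ j, x j * (v x * pdir n j v x) = v x * Dop n v x := by
        rw [Dop, Finset.mul_sum]
        exact Finset.sum_congr rfl fun j _ => by ring
      have s3 : ∑ j, x j * (x j * (v x * v x)) = ‖x‖ ^ 2 * v x ^ 2 := by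
        rw [norm_sq_eq_sum, Finset.sum_mul]
        exact Finset.sum_congr rfl fun j _ => by ring
      have s4 : ∑ j, pdir n j v x * pdir n j v x = gsq n v x := by
        rw [gsq]; exact Finset.sum_congr rfl fun j _ => by ring
      rw [s1, s2, s3, s4]
      have hexp : Real.exp (-(2 * m) * Real.log ‖x‖) =
          ‖x‖ ^ 2 * Real.exp (-n * Real.log ‖x‖) := by
        rw [← exp_log_norm hx.1]; congr 2; rw [hm]; ring
      simp only [hgA, hgB, hgC, hgA', hgB', hgC', hexp]
      have hr : ‖x‖ ≠ 0 := norm_ne_zero_iff.2 hx.1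
      have hE := Real.exp_pos (-n * Real.log ‖x‖)
      have hq1n := hneg _ hx.2
      generalize Real.exp (-n * Real.log ‖x‖) = e at *
      generalize q (Real.log ‖x‖) = Q at *
      generalize q1 (Real.log ‖x‖) = Q1 at *
      generalize q2 (Real.log ‖x‖) = Q2 at *
      generalize q3 (Real.log ‖x‖) = Q3 at *
      generalize Dop n v x = d
      generalize gsq n v x = G
      generalize lapl n v x = L
      generalize v x = z
      generalize ‖x‖ = r at *
      have pos : 0 ≤ e * ((r ^ 2 * L - 2 * m * d + (Q ^ 2 - m ^ 2) * z) ^ 2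
          + (2 * Q * d + Q1 * z) ^ 2 - 4 * Q1 * d ^ 2) := by
        refine mul_nonneg hE.le ?_
        nlinarith [sq_nonneg d, sq_nonneg (r ^ 2 * L - 2 * m * d + (Q ^ 2 - m ^ 2) * z),
          sq_nonneg (2 * Q * d + Q1 * z), mul_nonneg (neg_nonneg.2 hq1n) (sq_nonneg d)]
      refine le_trans (le_of_eq ?_) (sub_le_self _ pos)
      rw [hm]
      field_simp
      ring
    · have z1 : v x = 0 := hv.eq_zero hx
      have z2 : Dop n v x = 0 := hv.dop.eq_zero hx
      have z3 : gsq n v x = 0 := hv.gsq.eq_zero hx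
      have z4 : lapl n v x = 0 := hv.lapl.eq_zero hx
      rw [div_A hv, div_B hv hv, div_C hv]
      have s4 : ∑ j, pdir n j v x * pdir n j v x = gsq n v x := by
        rw [gsq]; exact Finset.sum_congr rfl fun j _ => by ring
      rw [s4]
      simp [z1, z2, z3, z4]

/-- the phase -/
def psi (t : ℝ) : ℝ := t + Real.log (t ^ 2)

/-- the total weight in the logarithmic variable -/
def om (n : ℕ) (b t : ℝ) : ℝ := Real.exp (-n * t - 2 * b * psi t)

lemma om_pos (b t : ℝ) : 0 < om n b t := Real.exp_pos _

lemma psi_hasDerivAt {t : ℝ} (ht : t < -4) : HasDerivAt psi (1 + 2 / t) t := by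
  have h0 : t ≠ 0 := by linarith
  have h1 : HasDerivAt (fun t : ℝ => t ^ 2) (2 * t) t := by simpa using hasDerivAt_pow 2 t
  have := (hasDerivAt_id t).add (h1.log (by positivity))
  refine this.congr_deriv ?_
  field_simp

lemma psi_contDiffAt {t : ℝ} (ht : t < -4) {k : WithTop ℕ∞} : ContDiffAt ℝ k psi t := by
  have h0 : t ≠ 0 := by linarith
  unfold psi
  exact contDiffAt_id.add ((contDiffAt_id.pow 2).log (by simpa using h0))

lemma psi_continuousOn : ContinuousOn psi (Iio (-4)) := fun _ ht =>
  (psi_hasDerivAt ht).continuousAt.continuousWithinAt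

lemma om_continuousOn (b : ℝ) : ContinuousOn (om n b) (Iio (-4)) := by
  unfold om
  have := psi_continuousOn
  fun_prop

lemma om_hasDerivAt (b : ℝ) {t : ℝ} (ht : t < -4) :
    HasDerivAt (om n b) ((-n - 2 * b * (1 + 2 / t)) * om n b t) t := by
  have := (((hasDerivAt_id t).const_mul (-n : ℝ)).sub ((psi_hasDerivAt ht).const_mul (2 * b))).exp
  refine HasDerivAt.congr_deriv (f := om n b) this ?_
  simp [om, mul_comm]

lemma inv_cont : ContinuousOn (fun t : ℝ => t⁻¹) (Iio (-4)) :=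
  continuousOn_inv₀.mono fun t ht => by
    have : t < -4 := ht
    simp; linarith

lemma inv_hasDerivAt {t : ℝ} (ht : t < -4) (c : ℝ) (k : ℕ) :
    HasDerivAt (fun t : ℝ => c / t ^ k) (-(k * c) / t ^ (k + 1)) t := by
  have h0 : t ≠ 0 := by linarith
  have := (((hasDerivAt_inv h0).fun_pow k).const_mul c)
  simp only [← div_eq_mul_inv, inv_pow] at this
  refine this.congr_deriv ?_
  rcases k with _ | k
  · simp
  · simp; field_simp; ring

lemma carleman_L2 {b : ℝ} (hb : 1 ≤ b) (hn : 2 ≤ n)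
    {W : EuclideanSpace ℝ (Fin n) → ℝ} (hW : Adm n (-4) W) :
    b ^ 3 * ∫ x : EuclideanSpace ℝ (Fin n),
        om n b (Real.log ‖x‖) * (Real.log ‖x‖)⁻¹ ^ 2 * W x ^ 2 ≤
      ∫ x : EuclideanSpace ℝ (Fin n), om n b (Real.log ‖x‖) * (‖x‖ ^ 2 * lapl n W x) ^ 2 := by
  obtain ⟨m, hm⟩ : ∃ m : ℝ, (n : ℝ) = 2 * m + 2 := ⟨(n - 2) / 2, by ring⟩
  have hm0 : 0 ≤ m := by
    have : (2 : ℝ) ≤ n := by exact_mod_cast hn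
    linarith
  set v : EuclideanSpace ℝ (Fin n) → ℝ := fun x => Real.exp (-b * psi (Real.log ‖x‖)) * W x with hv
  have av : Adm n (-4) v := by
    refine hW.mul_contDiffAt fun x hx => ?_
    have h1 := (psi_contDiffAt (k := (⊤ : ℕ∞)) hx.2).comp x (log_norm_contDiffAt hx.1)
    exact (contDiffAt_const.mul h1).exp
  have hWv : W = fun y => (fun t => Real.exp (b * psi t)) (Real.log ‖y‖) * v y := by
    funext y
    simp only [hv, ← mul_assoc, ← Real.exp_add]
    simp
  set q : ℝ → ℝ := fun t => b * (1 + 2 / t) + m with hq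
  have dpsi1 : ∀ t < (-4:ℝ), HasDerivAt (fun t : ℝ => 1 + 2 / t) (-2 / t ^ 2) t := fun t ht => by
    simpa using (inv_hasDerivAt ht 2 1).const_add 1
  have dq : ∀ t < (-4:ℝ), HasDerivAt q (b * (-2 / t ^ 2)) t := fun t ht =>
    ((dpsi1 t ht).const_mul b).add_const m
  have dq1 : ∀ t < (-4:ℝ), HasDerivAt (fun t => b * (-2 / t ^ 2)) (b * (4 / t ^ 3)) t :=
    fun t ht => by
      have := (inv_hasDerivAt ht (-2) 2).const_mul b
      refine this.congr_deriv ?_; norm_num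
  have dq2 : ∀ t < (-4:ℝ), HasDerivAt (fun t => b * (4 / t ^ 3)) (b * (-12 / t ^ 4)) t :=
    fun t ht => by
      have := (inv_hasDerivAt ht 4 3).const_mul b
      refine this.congr_deriv ?_; norm_num
  have cq3 : ContinuousOn (fun t : ℝ => b * (-12 / t ^ 4)) (Iio (-4)) := fun t ht =>
    ((inv_hasDerivAt ht (-12) 4).const_mul b).continuousAt.continuousWithinAt
  have key := carleman_v m hm dq dq1 dq2 cq3 (fun t ht => by
    have : 0 ≤ b * (2 / t ^ 2) := by positivity
    have e : b * (-2 / t ^ 2) = - (b * (2 / t ^ 2)) := by ring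
    linarith) av
  have cont := inv_cont
  have cpsi := psi_continuousOn
  have com := om_continuousOn (n := n) b
  have i1 : Integrable fun x : EuclideanSpace ℝ (Fin n) =>
      om n b (Real.log ‖x‖) * (Real.log ‖x‖)⁻¹ ^ 2 * W x ^ 2 := by
    have hc : ContinuousOn (fun t : ℝ => om n b t * t⁻¹ ^ 2) (Iio (-4)) := by fun_prop
    simpa [sq] using (hW.mul hW).integrable hc
  have i2 : Integrable fun x : EuclideanSpace ℝ (Fin n) => Real.exp (-n * Real.log ‖x‖) *
      ((-4 * q (Real.log ‖x‖) ^ 2 * (b * (-2 / Real.log ‖x‖ ^ 2)) + b * (-12 / Real.log ‖x‖ ^ 4))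
       * v x ^ 2) := by
    have hc : ContinuousOn (fun t : ℝ => Real.exp (-n * t) *
        (-4 * q t ^ 2 * (b * (-2 / t ^ 2)) + b * (-12 / t ^ 4))) (Iio (-4)) := by
      simp only [hq, div_eq_mul_inv, ← inv_pow]
      fun_prop
    refine ((av.mul av).integrable hc).congr (Filter.Eventually.of_forall fun x => ?_)
    simp only
    ring
  rw [← integral_const_mul]
  refine le_trans (integral_mono (i1.const_mul _) i2 ?_) (key.trans (le_of_eq ?_))
  · intro x
    simp only
    by_cases hx : x ∈ UT n (-4)
    · have ht := hx.2
      have e1 : om n b (Real.log ‖x‖) * W x ^ 2 = Real.exp (-n * Real.log ‖x‖) * v x ^ 2 := by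
        simp only [hv, om, mul_pow, ← mul_assoc, ← Real.exp_nat_mul, ← Real.exp_add]
        congr 2; push_cast; ring
      rw [show b ^ 3 * (om n b (Real.log ‖x‖) * (Real.log ‖x‖)⁻¹ ^ 2 * W x ^ 2) =
        b ^ 3 * (Real.log ‖x‖)⁻¹ ^ 2 * (om n b (Real.log ‖x‖) * W x ^ 2) by ring, e1]
      rw [mul_left_comm (Real.exp _)]
      refine mul_le_mul_of_nonneg_right ?_ (by positivity)
      generalize Real.log ‖x‖ = t at ht
      have h0 : t ≠ 0 := by linarith
      have hq' : b / 2 ≤ q t := by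
        have : -(1/2) ≤ 2 / t := by
          rw [le_div_iff_of_neg (by linarith)]; linarith
        simp only [hq]
        nlinarith
      have hq2 : b ^ 2 / 4 ≤ q t ^ 2 := by nlinarith
      have e2 : -4 * q t ^ 2 * (b * (-2 / t ^ 2)) + b * (-12 / t ^ 4) =
        t⁻¹ ^ 2 * (8 * b * q t ^ 2 - 12 * b * t⁻¹ ^ 2) := by field_simp; ring
      rw [e2, mul_comm]
      refine mul_le_mul_of_nonneg_left ?_ (by positivity)
      have e3 : t⁻¹ ^ 2 ≤ 1 / 16 := by
        rw [inv_pow, ← one_div]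
        exact one_div_le_one_div_of_le (by norm_num) (by nlinarith)
      have hb2 : 1 ≤ b ^ 2 := by nlinarith
      nlinarith [mul_le_mul_of_nonneg_left e3 (by linarith : 0 ≤ b),
        mul_le_mul_of_nonneg_left hq2 (by linarith : 0 ≤ b),
        mul_le_mul_of_nonneg_left hb2 (by linarith : 0 ≤ b)]
    · simp [hW.eq_zero hx, av.eq_zero hx]
  · refine integral_congr_ae (Filter.Eventually.of_forall fun x => ?_)
    simp only
    by_cases hx : x ∈ UT n (-4)
    · have dp : ∀ t < (-4:ℝ), HasDerivAt (fun t => Real.exp (b * psi t))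
          (b * (1 + 2 / t) * Real.exp (b * psi t)) t := fun t ht => by
        have := ((psi_hasDerivAt ht).const_mul b).exp
        simpa [mul_comm] using this
      have dp1 : ∀ t < (-4:ℝ), HasDerivAt (fun t => b * (1 + 2 / t) * Real.exp (b * psi t))
          (b * (-2 / t ^ 2) * Real.exp (b * psi t) +
            b * (1 + 2 / t) * (b * (1 + 2 / t) * Real.exp (b * psi t))) t := fun t ht =>
        ((dpsi1 t ht).const_mul b).mul (dp t ht)
      have hl := lapl_radial_mul dp dp1 av hx
      rw [← hWv] at hl
      rw [hl]
      simp only [om, hq]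
      rw [sub_eq_add_neg (-n * Real.log ‖x‖), Real.exp_add]
      have ee : Real.exp (-(2 * b * psi (Real.log ‖x‖))) * Real.exp (b * psi (Real.log ‖x‖)) ^ 2 = 1 := by
        rw [← Real.exp_nat_mul, ← Real.exp_add, ← Real.exp_zero]
        congr 1; push_cast; ring
      rw [hm]
      generalize Real.exp (-(2 * b * psi (Real.log ‖x‖))) = E' at ee ⊢
      generalize Real.exp (b * psi (Real.log ‖x‖)) = E at ee ⊢
      generalize 1 + 2 / Real.log ‖x‖ = P
      generalize -2 / Real.log ‖x‖ ^ 2 = P2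
      generalize Real.exp (-(2 * m + 2) * Real.log ‖x‖) = E0
      generalize lapl n v x = L
      generalize Dop n v x = D
      generalize v x = V
      linear_combination (-E0 * (‖x‖ ^ 2 * L - 2 * m * D
        + ((b * P + m) ^ 2 - m ^ 2) * V
        + (2 * (b * P + m) * D
        + b * P2 * V)) ^ 2) * ee
    · simp [hW.lapl.eq_zero hx, av.lapl.eq_zero hx, av.dop.eq_zero hx, av.eq_zero hx]

lemma cacc_pointwise {w G r c1 c2 K A B D Γ F : ℝ} (hr : 0 < r) (hK : 1 ≤ K)
    (h1 : |c1| ≤ K) (h2 : |c2| ≤ K) (hΓ : 0 ≤ Γ) (hF : 0 ≤ F)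
    (hA : A ^ 2 ≤ Γ * F) (hB : B ^ 2 ≤ r ^ 2 * F) (hD : D ^ 2 ≤ r ^ 2 * Γ) :
    -(w * G) - r * A - c2 * w * (B / r) - c1 * w * D ≤
      r ^ 2 * Γ / 2 + 2 * K ^ 2 * w ^ 2 + G ^ 2 / 2 + 3 / 2 * F := by
  have a1 : -(r * A) ≤ r ^ 2 * Γ / 4 + F := by
    have : |r * A| ≤ r ^ 2 * Γ / 4 + F := by
      refine abs_le_of_sq_le_sq ?_ (by positivity)
      have : (r * A) ^ 2 ≤ r ^ 2 * (Γ * F) := by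
        rw [mul_pow]; exact mul_le_mul_of_nonneg_left hA (by positivity)
      nlinarith [sq_nonneg (r ^ 2 * Γ / 4 - F)]
    linarith [neg_abs_le (r * A)]
  have b1 : (B / r) ^ 2 ≤ F := by
    rw [div_pow, div_le_iff₀ (by positivity)]; linarith
  have c1' : c1 ^ 2 ≤ K ^ 2 := sq_le_sq' (by linarith [neg_abs_le c1]) (by linarith [le_abs_self c1])
  have c2' : c2 ^ 2 ≤ K ^ 2 := sq_le_sq' (by linarith [neg_abs_le c2]) (by linarith [le_abs_self c2])
  have d1 := mul_le_mul_of_nonneg_right c1' (sq_nonneg w)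
  have d2 := mul_le_mul_of_nonneg_right c2' (sq_nonneg w)
  have a2 : -(c2 * w * (B / r)) ≤ K ^ 2 * w ^ 2 / 2 + F / 2 := by
    nlinarith [sq_nonneg (c2 * w + B / r)]
  have a3 : -(c1 * w * D) ≤ K ^ 2 * w ^ 2 + r ^ 2 * Γ / 4 := by
    nlinarith [sq_nonneg (c1 * w + D / 2)]
  have hK2 : 1 ≤ K ^ 2 := by nlinarith
  have a4 : w ^ 2 ≤ K ^ 2 * w ^ 2 := by nlinarith [sq_nonneg w]
  nlinarith [sq_nonneg (w + G)]

/-- the weight `ω t⁻²` -/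
def kap (n : ℕ) (b t : ℝ) : ℝ := om n b t * t⁻¹ ^ 2

lemma kap_continuousOn (b : ℝ) : ContinuousOn (kap n b) (Iio (-4)) := by
  have cont := inv_cont
  have com := om_continuousOn (n := n) b
  unfold kap
  fun_prop

lemma kap_nonneg (b t : ℝ) : 0 ≤ kap n b t := mul_nonneg (om_pos b t).le (by positivity)

lemma kap_hasDerivAt (b c : ℝ) {t : ℝ} (ht : t < -4) :
    HasDerivAt (fun t => kap n b t * Real.exp (c * t))
      ((c - n - 2 * b * (1 + 2 / t) - 2 / t) * (kap n b t * Real.exp (c * t))) t := by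
  have h0 : t ≠ 0 := by linarith
  have h1 : HasDerivAt (fun t : ℝ => t⁻¹ ^ 2) (-2 / t ^ 3) t := by
    have := inv_hasDerivAt ht 1 2
    simpa using this
  have := ((om_hasDerivAt (n := n) b ht).fun_mul h1).fun_mul (hasDerivAt_expc c t)
  refine HasDerivAt.congr_deriv this ?_
  simp only [kap]
  field_simp
  ring

lemma cauchy_schwarz_sq (a c : Fin n → ℝ) :
    (∑ j, a j * c j) ^ 2 ≤ (∑ j, a j ^ 2) * ∑ j, c j ^ 2 :=
  Finset.sum_mul_sq_le_sq_mul_sq _ _ _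

lemma caccioppoli {b : ℝ} (hb : 1 ≤ b)
    {w : EuclideanSpace ℝ (Fin n) → ℝ} (hw : Adm n (-4) w)
    {f : Fin n → EuclideanSpace ℝ (Fin n) → ℝ} (hf : ∀ j, Adm n (-4) (f j)) :
    ∫ x : EuclideanSpace ℝ (Fin n), kap n b (Real.log ‖x‖) * (‖x‖ ^ 2 * gsq n w x) ≤
      4 * ((n + 5) * b) ^ 2 * (∫ x : EuclideanSpace ℝ (Fin n), kap n b (Real.log ‖x‖) * w x ^ 2)
      + (∫ x : EuclideanSpace ℝ (Fin n), kap n b (Real.log ‖x‖) *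
          (‖x‖ ^ 2 * lapl n w x + ‖x‖ * ∑ j, pdir n j (f j) x) ^ 2)
      + 3 * ∫ x : EuclideanSpace ℝ (Fin n), kap n b (Real.log ‖x‖) * ∑ j, f j x ^ 2 := by
  set K : ℝ := (n + 5) * b with hK
  have hn0 : (0:ℝ) ≤ n := Nat.cast_nonneg n
  have hK1 : 1 ≤ K := by nlinarith
  have ck := kap_continuousOn (n := n) b
  have cont := inv_cont
  set c : ℝ → ℝ → ℝ := fun e t => e - n - 2 * b * (1 + 2 / t) - 2 / t with hc
  set g : ℝ → ℝ → ℝ := fun e t => kap n b t * Real.exp (e * t) with hg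
  have cg : ∀ e, ContinuousOn (g e) (Iio (-4)) := fun e => by
    simp only [hg]; fun_prop
  have cg' : ∀ e, ContinuousOn (fun t => c e t * g e t) (Iio (-4)) := fun e => by
    have := cg e
    simp only [hc, div_eq_mul_inv]; fun_prop
  have dg : ∀ e, ∀ t < (-4:ℝ), HasDerivAt (g e) (c e t * g e t) t := fun e t ht =>
    kap_hasDerivAt b e ht
  have cb : ∀ e, 0 ≤ e → e ≤ 2 → ∀ t < (-4:ℝ), |c e t| ≤ K := by
    intro e he he2 t ht
    have h1 : -(1/2) ≤ 2 / t := by rw [le_div_iff_of_neg (by linarith)]; linarith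
    have h2 : 2 / t ≤ 0 := div_nonpos_of_nonneg_of_nonpos (by norm_num) (by linarith)
    simp only [hc, hK]
    rw [abs_le]
    constructor <;> nlinarith
  have a1 : ∀ j, Adm n (-4) (fun y => w y * pdir n j w y) := fun j => hw.mul (hw.pdir j)
  have a2 : ∀ j, Adm n (-4) (fun y => w y * f j y) := fun j => hw.mul (hf j)
  have aF : Adm n (-4) (fun x => ∑ j, f j x ^ 2) := by
    simpa [sq] using Adm.sum Finset.univ fun j _ => (hf j).mul (hf j)
  have sumI : ∀ {g : ℝ → ℝ} (_ : ContinuousOn g (Iio (-4)))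
      {h : Fin n → EuclideanSpace ℝ (Fin n) → ℝ} (_ : ∀ j, Adm n (-4) (h j)),
      Integrable fun x : EuclideanSpace ℝ (Fin n) =>
        g (Real.log ‖x‖) * ∑ j, pdir n j (h j) x := fun hg _ ah =>
    (Adm.sum Finset.univ fun j _ => (ah j).pdir j).integrable hg
  have sumI' : ∀ {g : ℝ → ℝ} (_ : ContinuousOn g (Iio (-4)))
      {h : Fin n → EuclideanSpace ℝ (Fin n) → ℝ} (_ : ∀ j, Adm n (-4) (h j)),
      Integrable fun x : EuclideanSpace ℝ (Fin n) =>
        g (Real.log ‖x‖) * ((∑ j, x j * h j x) / ‖x‖ ^ 2) := by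
    intro g hg h ah
    have hadm : Adm n (-4) (fun x : EuclideanSpace ℝ (Fin n) => ‖x‖⁻¹ ^ 2 * ∑ j, x j * h j x) := by
      refine (Adm.sum Finset.univ fun j _ => (ah j).mul_smooth (coord_smooth j)).mul_contDiffAt ?_
      intro x hx
      exact ((contDiffAt_norm ℝ hx.1).inv (norm_ne_zero_iff.2 hx.1)).pow 2
    refine (hadm.integrable hg).congr (Filter.Eventually.of_forall fun x => ?_)
    simp only [inv_pow]
    ring
  have e1 := div_radial (dg 2) (cg' 2) a1
  have e2 := div_radial (dg 1) (cg' 1) a2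
  have i1 := sumI (cg 2) a1
  have i1' := sumI' (cg' 2) a1
  have i2 := sumI (cg 1) a2
  have i2' := sumI' (cg' 1) a2
  have hr2 : ContDiff ℝ (⊤ : ℕ∞) (fun x : EuclideanSpace ℝ (Fin n) => ‖x‖ ^ 2) :=
      contDiff_norm_sq ℝ
  have iL : Integrable fun x : EuclideanSpace ℝ (Fin n) =>
      kap n b (Real.log ‖x‖) * (‖x‖ ^ 2 * gsq n w x) := (hw.gsq.mul_smooth hr2).integrable ck
  have iw : Integrable fun x : EuclideanSpace ℝ (Fin n) => kap n b (Real.log ‖x‖) * w x ^ 2 := by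
    simpa [sq] using (hw.mul hw).integrable ck
  have iF := aF.integrable ck
  have aG : Adm n (-4) (fun x => ‖x‖ ^ 2 * lapl n w x + ‖x‖ * ∑ j, pdir n j (f j) x) :=
    (hw.lapl.mul_smooth hr2).add
      ((Adm.sum Finset.univ fun j _ => (hf j).pdir j).mul_contDiffAt fun x hx =>
        contDiffAt_norm ℝ hx.1)
  have iG : Integrable fun x : EuclideanSpace ℝ (Fin n) => kap n b (Real.log ‖x‖) *
      (‖x‖ ^ 2 * lapl n w x + ‖x‖ * ∑ j, pdir n j (f j) x) ^ 2 := by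
    simpa [sq] using (aG.mul aG).integrable ck
  have hle := integral_mono ((iL.const_mul (1/2)))
    ((((((iw.const_mul (2 * K ^ 2)).add (iG.const_mul (1/2))).add (iF.const_mul (3/2))).add i1).add
      i1').add i2 |>.add i2') ?_
  · rw [integral_add' (((((((iw.const_mul (2 * K ^ 2)).add (iG.const_mul (1/2))).add
        (iF.const_mul (3/2))).add i1).add i1').add i2)) i2',
      integral_add' ((((((iw.const_mul (2 * K ^ 2)).add (iG.const_mul (1/2))).add
        (iF.const_mul (3/2))).add i1).add i1')) i2,
      integral_add' (((((iw.const_mul (2 * K ^ 2)).add (iG.const_mul (1/2))).add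
        (iF.const_mul (3/2))).add i1)) i1',
      integral_add' ((((iw.const_mul (2 * K ^ 2)).add (iG.const_mul (1/2))).add
        (iF.const_mul (3/2)))) i1,
      integral_add' (((iw.const_mul (2 * K ^ 2)).add (iG.const_mul (1/2)))) (iF.const_mul (3/2)),
      integral_add' (iw.const_mul (2 * K ^ 2)) (iG.const_mul (1/2)), e1, e2] at hle
    simp only [integral_const_mul] at hle
    linarith
  · intro x
    simp only [Pi.add_apply]
    by_cases hx : x ∈ UT n (-4)
    · rw [div_B hw hw]
      have e3 : ∑ j, pdir n j (fun y => w y * f j y) x =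
          w x * ∑ j, pdir n j (f j) x + ∑ j, pdir n j w x * f j x := by
        rw [Finset.sum_congr rfl fun j _ => pdir_mul j (hw.diff x) ((hf j).diff x),
          Finset.sum_add_distrib, Finset.mul_sum]
      have s2 : ∑ j, x j * (w x * pdir n j w x) = w x * Dop n w x := by
        rw [Dop, Finset.mul_sum]
        exact Finset.sum_congr rfl fun j _ => by ring
      have s3 : ∑ j, x j * (w x * f j x) = w x * ∑ j, x j * f j x := by
        rw [Finset.mul_sum]
        exact Finset.sum_congr rfl fun j _ => by ring
      have s4 : ∑ j, pdir n j w x * pdir n j w x = gsq n w x := by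
        rw [gsq]; exact Finset.sum_congr rfl fun j _ => by ring
      rw [e3, s2, s3, s4]
      have hr : 0 < ‖x‖ := norm_pos_iff.2 hx.1
      have x2 : Real.exp (2 * Real.log ‖x‖) = ‖x‖ ^ 2 := by
        have := exp_log_norm hx.1 0
        simpa using this
      have x1 : Real.exp (1 * Real.log ‖x‖) = ‖x‖ := by rw [one_mul, Real.exp_log hr]
      have key := cacc_pointwise (w := w x)
        (G := ‖x‖ ^ 2 * lapl n w x + ‖x‖ * ∑ j, pdir n j (f j) x) (A := ∑ j, pdir n j w x * f j x)
        (B := ∑ j, x j * f j x) (D := Dop n w x) (Γ := gsq n w x) (F := ∑ j, f j x ^ 2)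
        hr hK1 (cb 2 (by norm_num) (by norm_num) _ hx.2) (cb 1 (by norm_num) (by norm_num) _ hx.2)
        (Finset.sum_nonneg fun _ _ => sq_nonneg _) (Finset.sum_nonneg fun _ _ => sq_nonneg _)
        (cauchy_schwarz_sq _ _) (by rw [norm_sq_eq_sum]; exact cauchy_schwarz_sq _ _)
        (by rw [norm_sq_eq_sum]; exact cauchy_schwarz_sq _ _)
      have hk := kap_nonneg (n := n) b (Real.log ‖x‖)
      have key2 := mul_le_mul_of_nonneg_left key hk
      simp only [hg, x1, x2]
      generalize kap n b (Real.log ‖x‖) = k at *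
      generalize c 2 (Real.log ‖x‖) = c2 at *
      generalize c 1 (Real.log ‖x‖) = c1 at *
      generalize Dop n w x = D at *
      generalize gsq n w x = Γ at *
      generalize lapl n w x = L at *
      generalize ∑ j, x j * f j x = B at *
      generalize ∑ j, f j x ^ 2 = F at *
      generalize ∑ j, pdir n j (f j) x = Q at *
      generalize ∑ j, pdir n j w x * f j x = A at *
      generalize w x = w at *
      generalize ‖x‖ = r at *
      have q1 : c2 * (k * r ^ 2) * (w * D / r ^ 2) = k * (c2 * w * D) := by field_simp
      have q2 : c1 * (k * r) * (w * B / r ^ 2) = k * (c1 * w * (B / r)) := by field_simp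
      rw [q1, q2]
      linarith
    · have s4 : ∀ j, f j x = 0 := fun j => (hf j).eq_zero hx
      have s5 : ∀ j, pdir n j (f j) x = 0 := fun j => ((hf j).pdir j).eq_zero hx
      have s6 : ∀ j, pdir n j (fun y => w y * pdir n j w y) x = 0 :=
        fun j => ((a1 j).pdir j).eq_zero hx
      have s7 : ∀ j, pdir n j (fun y => w y * f j y) x = 0 :=
        fun j => ((a2 j).pdir j).eq_zero hx
      simp [hw.eq_zero hx, hw.gsq.eq_zero hx, hw.lapl.eq_zero hx, s4, s5, s6, s7]

section shift
variable {Z : Type*} [MeasurableSpace Z] {ν : Measure Z} [IsFiniteMeasure ν]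
  {τ : Z → EuclideanSpace ℝ (Fin n)} {φ : Z → ℝ} {M : ℝ}

/-- averages of translates -/
def shiftAvg (ν : Measure Z) (φ : Z → ℝ) (τ : Z → EuclideanSpace ℝ (Fin n))
    (h : EuclideanSpace ℝ (Fin n) → ℝ) (x : EuclideanSpace ℝ (Fin n)) : ℝ :=
  ∫ ζ, φ ζ * h (x + τ ζ) ∂ν

lemma bounded_of_cpt {F : Type*} [NormedAddCommGroup F] {h : EuclideanSpace ℝ (Fin n) → F}
    (hc : Continuous h)
    (hs : HasCompactSupport h) : ∃ C, ∀ x, ‖h x‖ ≤ C := hs.exists_bound_of_continuous hc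

lemma shift_integrable (hτ : Measurable τ) (hφ : Measurable φ) (hM : ∀ ζ, |φ ζ| ≤ M)
    {h : EuclideanSpace ℝ (Fin n) → ℝ}
    (hc : Continuous h) (hs : HasCompactSupport h) (x : EuclideanSpace ℝ (Fin n)) :
    Integrable (fun ζ => φ ζ * h (x + τ ζ)) ν := by
  obtain ⟨C, hC⟩ := bounded_of_cpt hc hs
  refine Integrable.of_bound (C := M * C) ?_ ?_
  · exact (hφ.mul (hc.measurable.comp (hτ.const_add x))).aestronglyMeasurable
  · refine Filter.Eventually.of_forall fun ζ => ?_
    rw [norm_mul]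
    exact mul_le_mul (hM ζ) (hC _) (norm_nonneg _) ((abs_nonneg _).trans (hM ζ))

lemma shift_hasFDerivAt (hτ : Measurable τ) (hφ : Measurable φ) (hM : ∀ ζ, |φ ζ| ≤ M)
    {h : EuclideanSpace ℝ (Fin n) → ℝ}
    (hc : ContDiff ℝ (⊤ : ℕ∞) h) (hs : HasCompactSupport h) (x : EuclideanSpace ℝ (Fin n)) :
    Integrable (fun ζ => φ ζ • fderiv ℝ h (x + τ ζ)) ν ∧
    HasFDerivAt (shiftAvg ν φ τ h) (∫ ζ, φ ζ • fderiv ℝ h (x + τ ζ) ∂ν) x := by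
  have hc' : Continuous (fderiv ℝ h) := hc.continuous_fderiv (by simp)
  obtain ⟨C, hC⟩ := bounded_of_cpt hc' (hs.fderiv (𝕜 := ℝ))
  have hm : AEStronglyMeasurable (fun ζ => φ ζ • fderiv ℝ h (x + τ ζ)) ν :=
    (hφ.aestronglyMeasurable).smul
      ((hc'.stronglyMeasurable.comp_measurable (hτ.const_add x)).aestronglyMeasurable)
  have hb : ∀ ζ y, ‖φ ζ • fderiv ℝ h (y + τ ζ)‖ ≤ M * C := fun ζ y => by
    rw [norm_smul]
    exact mul_le_mul (hM ζ) (hC _) (norm_nonneg _) ((abs_nonneg _).trans (hM ζ))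
  refine ⟨Integrable.of_bound (C := M * C) hm (Filter.Eventually.of_forall fun ζ => hb ζ x), ?_⟩
  refine hasFDerivAt_integral_of_dominated_of_fderiv_le (bound := fun _ => M * C)
    (F' := fun y ζ => φ ζ • fderiv ℝ h (y + τ ζ))
    (s := univ) Filter.univ_mem ?_ ?_ hm ?_ (integrable_const _) ?_
  · exact Filter.Eventually.of_forall fun y =>
      (shift_integrable hτ hφ hM hc.continuous hs y).aestronglyMeasurable
  · exact shift_integrable hτ hφ hM hc.continuous hs x
  · exact Filter.Eventually.of_forall fun ζ y _ => hb ζ y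
  · refine Filter.Eventually.of_forall fun ζ y _ => ?_
    have h1 : HasFDerivAt h (fderiv ℝ h (y + τ ζ)) (y + τ ζ) :=
      (hc.differentiable (by simp) _).hasFDerivAt
    exact ((h1.comp y ((hasFDerivAt_id y).add_const (τ ζ)))).const_mul (φ ζ)

lemma shift_pdir (hτ : Measurable τ) (hφ : Measurable φ) (hM : ∀ ζ, |φ ζ| ≤ M)
    {h : EuclideanSpace ℝ (Fin n) → ℝ}
    (hc : ContDiff ℝ (⊤ : ℕ∞) h) (hs : HasCompactSupport h) (j : Fin n) :
    pdir n j (shiftAvg ν φ τ h) = shiftAvg ν φ τ (pdir n j h) := by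
  funext x
  obtain ⟨h1, h2⟩ := shift_hasFDerivAt (ν := ν) hτ hφ hM hc hs x
  rw [pdir, h2.fderiv, ContinuousLinearMap.integral_apply h1]
  rfl

lemma cpt_pdir {h : EuclideanSpace ℝ (Fin n) → ℝ} (hs : HasCompactSupport h) (j : Fin n) :
    HasCompactSupport (pdir n j h) :=
  hs.of_isClosed_subset (isClosed_tsupport _) (tsupport_pdir h j)

lemma fderiv_eq_sum (u : EuclideanSpace ℝ (Fin n) → ℝ) (x : EuclideanSpace ℝ (Fin n)) :
    fderiv ℝ u x = ∑ j, pdir n j u x • (EuclideanSpace.proj j : EuclideanSpace ℝ (Fin n) →L[ℝ] ℝ) := by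
  ext y
  rw [fderiv_apply_sum]
  simp [pdir, mul_comm]

lemma shift_contDiff (hτ : Measurable τ) (hφ : Measurable φ) (hM : ∀ ζ, |φ ζ| ≤ M)
    {h : EuclideanSpace ℝ (Fin n) → ℝ}
    (hc : ContDiff ℝ (⊤ : ℕ∞) h) (hs : HasCompactSupport h) :
    ContDiff ℝ (⊤ : ℕ∞) (shiftAvg ν φ τ h) := by
  rw [contDiff_infty]
  intro k
  induction k generalizing h with
  | zero =>
    have : Differentiable ℝ (shiftAvg ν φ τ h) := fun x =>
      (shift_hasFDerivAt hτ hφ hM hc hs x).2.differentiableAt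
    exact contDiff_zero.2 this.continuous
  | succ k ih =>
    have hd : Differentiable ℝ (shiftAvg ν φ τ h) := fun x =>
      (shift_hasFDerivAt hτ hφ hM hc hs x).2.differentiableAt
    push_cast
    rw [contDiff_succ_iff_fderiv]
    refine ⟨hd, by simp, ?_⟩
    have : fderiv ℝ (shiftAvg ν φ τ h) = fun x => ∑ j, shiftAvg ν φ τ (pdir n j h) x •
        (EuclideanSpace.proj j : EuclideanSpace ℝ (Fin n) →L[ℝ] ℝ) := by
      funext x
      rw [fderiv_eq_sum]
      simp only [shift_pdir hτ hφ hM hc hs]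
    rw [this]
    exact ContDiff.sum fun j _ =>
      (ih (pdir_smooth hc j) (cpt_pdir hs j)).smul contDiff_const

lemma shift_lapl (hτ : Measurable τ) (hφ : Measurable φ) (hM : ∀ ζ, |φ ζ| ≤ M)
    {h : EuclideanSpace ℝ (Fin n) → ℝ}
    (hc : ContDiff ℝ (⊤ : ℕ∞) h) (hs : HasCompactSupport h) (x : EuclideanSpace ℝ (Fin n)) :
    lapl n (shiftAvg ν φ τ h) x = shiftAvg ν φ τ (lapl n h) x := by
  have h1 : ∀ j, pdir n j (pdir n j (shiftAvg ν φ τ h)) x =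
      ∫ ζ, φ ζ * pdir n j (pdir n j h) (x + τ ζ) ∂ν := fun j => by
    rw [shift_pdir hτ hφ hM hc hs, shift_pdir hτ hφ hM (pdir_smooth hc j) (cpt_pdir hs j)]
    rfl
  simp only [lapl, h1, shiftAvg, Finset.mul_sum]
  rw [integral_finsetSum]
  exact fun j _ => shift_integrable hτ hφ hM (pdir_smooth (pdir_smooth hc j) j).continuous
    (cpt_pdir (cpt_pdir hs j) j) x

lemma sq_integral_le {f : Z → ℝ} (hf : Integrable f ν) (hf2 : Integrable (fun z => f z ^ 2) ν) :
    (∫ z, f z ∂ν) ^ 2 ≤ ν.real univ * ∫ z, f z ^ 2 ∂ν := by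
  set N := ν.real univ with hN
  set I := ∫ z, f z ∂ν with hI
  have hN0 : 0 ≤ N := measureReal_nonneg
  rcases hN0.eq_or_lt with h | h
  · have : ν = 0 := by
      rw [← Measure.measure_univ_eq_zero]
      have := h.symm
      rw [hN, measureReal_eq_zero_iff] at this
      exact this
    simp [hI, this]
  · have h1 : 0 ≤ ∫ z, (N ^ 2 * f z ^ 2 - 2 * N * I * f z + I ^ 2) ∂ν := by
      refine integral_nonneg fun z => ?_
      show 0 ≤ N ^ 2 * f z ^ 2 - 2 * N * I * f z + I ^ 2
      nlinarith [sq_nonneg (N * f z - I)]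
    have i1 : Integrable (fun z => N ^ 2 * f z ^ 2 - 2 * N * I * f z) ν :=
      (hf2.const_mul _).sub (hf.const_mul _)
    rw [integral_add i1 (integrable_const _),
      integral_sub (hf2.const_mul _) (hf.const_mul _), integral_const_mul, integral_const_mul,
      integral_const, ← hI, ← hN, smul_eq_mul] at h1
    have h2 : 0 ≤ N * (N * (∫ z, f z ^ 2 ∂ν) - I ^ 2) := by nlinarith
    have := nonneg_of_mul_nonneg_right h2 h
    linarith

lemma shift_total (hτ : Measurable τ) {h : EuclideanSpace ℝ (Fin n) → ℝ}
    (hc : Continuous h) (hs : HasCompactSupport h) :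
    Integrable (fun x => ∫ ζ, h (x + τ ζ) ∂ν) ∧
      ∫ x, ∫ ζ, h (x + τ ζ) ∂ν = ν.real univ * ∫ x, h x := by
  have hi : Integrable h := hc.integrable_of_hasCompactSupport hs
  have hp : Integrable (fun p : EuclideanSpace ℝ (Fin n) × Z => h (p.1 + τ p.2))
      (volume.prod ν) := by
    rw [integrable_prod_iff']
    · refine ⟨Filter.Eventually.of_forall fun ζ => hi.comp_add_right (τ ζ), ?_⟩
      have : ∀ ζ, ∫ x, ‖h (x + τ ζ)‖ = ∫ x, ‖h x‖ := fun ζ =>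
        integral_add_right_eq_self (fun x => ‖h x‖) (τ ζ)
      simp only [this]
      exact integrable_const _
    · exact (hc.measurable.comp
        (measurable_fst.add (hτ.comp measurable_snd))).aestronglyMeasurable
  refine ⟨hp.integral_prod_left, ?_⟩
  rw [integral_integral_swap hp]
  have : ∀ ζ, ∫ x, h (x + τ ζ) = ∫ x, h x := fun ζ => integral_add_right_eq_self h (τ ζ)
  simp only [this, integral_const, smul_eq_mul]

lemma shift_weighted {φ : Fin n → Z → ℝ} {s B D : ℝ} (hτ : Measurable τ)
    (hτs : ∀ᵐ ζ ∂ν, ‖τ ζ‖ ≤ s) (hφ : ∀ j, Measurable (φ j)) (hM : ∀ j ζ, |φ j ζ| ≤ M)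
    (hB : ∀ ζ, ∑ j, φ j ζ ^ 2 ≤ B)
    {F : Fin n → EuclideanSpace ℝ (Fin n) → ℝ} (hF : ∀ j, Continuous (F j))
    (hs : ∀ j, HasCompactSupport (F j)) {p : EuclideanSpace ℝ (Fin n) → ℝ} (hp : ∀ x, 0 ≤ p x)
    (hB0 : 0 ≤ B)
    (hpc : Continuous fun x => p x * ∑ j, F j x ^ 2)
    (hpD : ∀ x y, ‖y - x‖ ≤ s → (∃ j, F j y ≠ 0) → p x ≤ D * p y) :
    ∫ x, p x * (∑ j, shiftAvg ν (φ j) τ (F j) x) ^ 2 ≤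
      ν.real univ ^ 2 * B * D * ∫ x, p x * ∑ j, F j x ^ 2 := by
  set H : EuclideanSpace ℝ (Fin n) → ℝ := fun x => ∑ j, F j x ^ 2 with hH
  have cH : Continuous H := by fun_prop
  have sH : HasCompactSupport H := by
    have h1 : ∀ s : Finset (Fin n), HasCompactSupport (fun x => ∑ j ∈ s, F j x ^ 2) := by
      classical
      intro s
      induction s using Finset.induction_on with
      | empty => simp only [Finset.sum_empty]; exact HasCompactSupport.zero
      | insert a s ha ih =>
        simp only [Finset.sum_insert ha]
        refine HasCompactSupport.add ?_ ih
        simp only [sq]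
        exact (hs a).mul_left
    exact h1 Finset.univ
  have sPH : HasCompactSupport fun x => p x * H x := sH.mul_left
  obtain ⟨t1, t2⟩ := shift_total (ν := ν) hτ hpc sPH
  have hN0 : 0 ≤ ν.real univ := measureReal_nonneg
  have hpt : ∀ x, p x * (∑ j, shiftAvg ν (φ j) τ (F j) x) ^ 2 ≤
      ν.real univ * B * D * ∫ ζ, p (x + τ ζ) * H (x + τ ζ) ∂ν := by
    intro x
    have ii : ∀ j, Integrable (fun ζ => φ j ζ * F j (x + τ ζ)) ν := fun j =>
      shift_integrable hτ (hφ j) (hM j) (hF j) (hs j) x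
    have e1 : ∑ j, shiftAvg ν (φ j) τ (F j) x = ∫ ζ, ∑ j, φ j ζ * F j (x + τ ζ) ∂ν := by
      simp only [shiftAvg]
      rw [integral_finsetSum _ fun j _ => ii j]
    have iH : Integrable (fun ζ => H (x + τ ζ)) ν := by
      have := shift_integrable (ν := ν) (φ := fun _ => 1) (M := 1) hτ measurable_const (by simp)
        cH sH x
      simpa using this
    have iPH : Integrable (fun ζ => p (x + τ ζ) * H (x + τ ζ)) ν := by
      have := shift_integrable (ν := ν) (φ := fun _ => 1) (M := 1) hτ measurable_const (by simp)
        hpc sPH x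
      simpa using this
    have i0 : Integrable (fun ζ => ∑ j, φ j ζ * F j (x + τ ζ)) ν :=
      integrable_finsetSum _ fun j _ => ii j
    have hle : ∀ ζ, (∑ j, φ j ζ * F j (x + τ ζ)) ^ 2 ≤ B * H (x + τ ζ) := fun ζ =>
      (cauchy_schwarz_sq _ _).trans (mul_le_mul_of_nonneg_right (hB ζ)
        (Finset.sum_nonneg fun _ _ => sq_nonneg _))
    have i2 : Integrable (fun ζ => (∑ j, φ j ζ * F j (x + τ ζ)) ^ 2) ν := by
      refine (iH.const_mul B).mono' (i0.aestronglyMeasurable.pow 2) ?_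
      refine Filter.Eventually.of_forall fun ζ => ?_
      rw [Real.norm_eq_abs, abs_of_nonneg (sq_nonneg _)]
      exact hle ζ
    have h1 := sq_integral_le i0 i2
    have h2 : ∫ ζ, (∑ j, φ j ζ * F j (x + τ ζ)) ^ 2 ∂ν ≤ B * ∫ ζ, H (x + τ ζ) ∂ν := by
      rw [← integral_const_mul]
      exact integral_mono i2 (iH.const_mul B) hle
    have h3 : p x * ∫ ζ, H (x + τ ζ) ∂ν ≤ D * ∫ ζ, p (x + τ ζ) * H (x + τ ζ) ∂ν := by
      rw [← integral_const_mul, ← integral_const_mul]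
      refine integral_mono_ae (iH.const_mul _) (iPH.const_mul _) ?_
      filter_upwards [hτs] with ζ hζ
      by_cases hne : ∃ j, F j (x + τ ζ) ≠ 0
      · have := hpD x (x + τ ζ) (by simpa using hζ) hne
        have hh : 0 ≤ H (x + τ ζ) := Finset.sum_nonneg fun _ _ => sq_nonneg _
        simpa only [mul_assoc] using mul_le_mul_of_nonneg_right this hh
      · push Not at hne
        simp [hH, hne]
    rw [e1]
    calc p x * (∫ ζ, ∑ j, φ j ζ * F j (x + τ ζ) ∂ν) ^ 2
        ≤ p x * (ν.real univ * (B * ∫ ζ, H (x + τ ζ) ∂ν)) :=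
          mul_le_mul_of_nonneg_left (h1.trans (mul_le_mul_of_nonneg_left h2 hN0)) (hp x)
      _ = ν.real univ * B * (p x * ∫ ζ, H (x + τ ζ) ∂ν) := by ring
      _ ≤ ν.real univ * B * (D * ∫ ζ, p (x + τ ζ) * H (x + τ ζ) ∂ν) :=
          mul_le_mul_of_nonneg_left h3 (mul_nonneg hN0 hB0)
      _ = _ := by ring
  refine (integral_mono_of_nonneg (Filter.Eventually.of_forall fun x =>
    mul_nonneg (hp x) (sq_nonneg _)) (t1.const_mul _) (Filter.Eventually.of_forall hpt)).trans ?_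
  rw [integral_const_mul, t2]
  apply le_of_eq; ring

lemma shift_zero {φ : Z → ℝ} {s : ℝ} (hτs : ∀ᵐ ζ ∂ν, ‖τ ζ‖ ≤ s)
    {F : EuclideanSpace ℝ (Fin n) → ℝ} {x : EuclideanSpace ℝ (Fin n)}
    (hx : ∀ y, ‖y - x‖ ≤ s → F y = 0) : shiftAvg ν φ τ F x = 0 := by
  refine integral_eq_zero_of_ae ?_
  filter_upwards [hτs] with ζ hζ
  simp [hx (x + τ ζ) (by simpa using hζ)]

end shift

/-- radial bump -/
def eta (n : ℕ) (z : EuclideanSpace ℝ (Fin n)) : ℝ := Real.smoothTransition (1 - ‖z‖ ^ 2)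

lemma eta_smooth : ContDiff ℝ (⊤ : ℕ∞) (eta n) :=
  Real.smoothTransition.contDiff.comp (contDiff_const.sub (contDiff_norm_sq ℝ))

lemma eta_zero {z : EuclideanSpace ℝ (Fin n)} (hz : z ∉ Metric.closedBall 0 1) : eta n z = 0 := by
  have : 1 < ‖z‖ := by simpa using hz
  exact Real.smoothTransition.zero_of_nonpos (by nlinarith)

lemma eta_cpt : HasCompactSupport (eta n) :=
  HasCompactSupport.intro (isCompact_closedBall 0 1) fun _ hz => eta_zero hz

lemma eta_nonneg (z : EuclideanSpace ℝ (Fin n)) : 0 ≤ eta n z := Real.smoothTransition.nonneg _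

lemma eta_le_one (z : EuclideanSpace ℝ (Fin n)) : eta n z ≤ 1 := Real.smoothTransition.le_one _

lemma eta_int_pos : 0 < ∫ z, eta n z :=
  eta_smooth.continuous.integral_pos_of_hasCompactSupport_nonneg_nonzero (x := 0) eta_cpt
    eta_nonneg (by simp [eta])

lemma eta_pdir (z : EuclideanSpace ℝ (Fin n)) (i : Fin n) :
    pdir n i (eta n) z = deriv Real.smoothTransition (1 - ‖z‖ ^ 2) * (-2 * z i) := by
  have h1 : HasFDerivAt (fun y : EuclideanSpace ℝ (Fin n) => ‖y‖ ^ 2) (2 • innerSL ℝ z) z :=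
    (hasStrictFDerivAt_norm_sq z).hasFDerivAt
  have h2 : HasDerivAt Real.smoothTransition (deriv Real.smoothTransition (1 - ‖z‖ ^ 2))
      (1 - ‖z‖ ^ 2) :=
    ((Real.smoothTransition.contDiff (n := 1)).differentiable (by simp) _).hasDerivAt
  have h3 : HasFDerivAt (eta n) _ z := h2.comp_hasFDerivAt z (h1.const_sub 1)
  rw [pdir, h3.fderiv]
  simp [inner_single']

lemma etaz_pdir_symm (z : EuclideanSpace ℝ (Fin n)) (i j : Fin n) :
    pdir n i (fun y => eta n y * y j) z = pdir n j (fun y => eta n y * y i) z := by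
  have hd : DifferentiableAt ℝ (eta n) z := (eta_smooth.differentiable (by simp)) z
  rw [pdir_mul i hd (coord_diff j z), pdir_mul j hd (coord_diff i z), eta_pdir, eta_pdir,
    pdir_coord, pdir_coord]
  simp only [eq_comm (a := j)]
  ring

lemma etaz_smooth (j : Fin n) : ContDiff ℝ (⊤ : ℕ∞) (fun y => eta n y * y j) :=
  eta_smooth.mul (coord_smooth j)

lemma etaz_cpt (j : Fin n) : HasCompactSupport (fun y => eta n y * y j) := eta_cpt.mul_right

lemma abs_coord_le (z : EuclideanSpace ℝ (Fin n)) (j : Fin n) : |z j| ≤ ‖z‖ := by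
  simpa using PiLp.norm_apply_le z j

lemma etaz_bound (z : EuclideanSpace ℝ (Fin n)) (j : Fin n) : |eta n z * z j| ≤ 1 := by
  by_cases hz : z ∈ Metric.closedBall 0 1
  · rw [abs_mul, abs_of_nonneg (eta_nonneg z)]
    have : ‖z‖ ≤ 1 := by simpa using hz
    exact mul_le_one₀ (eta_le_one z) (abs_nonneg _) ((abs_coord_le z j).trans this)
  · simp [eta_zero hz]

lemma ibp_shift {a h : EuclideanSpace ℝ (Fin n) → ℝ} (ha : ContDiff ℝ (⊤ : ℕ∞) a)
    (hac : HasCompactSupport a) (hh : ContDiff ℝ (⊤ : ℕ∞) h)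
    (x : EuclideanSpace ℝ (Fin n)) (c : ℝ) (i : Fin n) :
    c * ∫ z, a z * pdir n i h (x + c • z) = - ∫ z, pdir n i a z * h (x + c • z) := by
  have hm : ContDiff ℝ (⊤ : ℕ∞) (fun z : EuclideanSpace ℝ (Fin n) => x + c • z) := by fun_prop
  have hd : ∀ z, HasFDerivAt (fun z => h (x + c • z)) (c • fderiv ℝ h (x + c • z)) z := fun z => by
    have h1 : HasFDerivAt h (fderiv ℝ h (x + c • z)) (x + c • z) :=
      (hh.differentiable (by simp) _).hasFDerivAt
    have h2 : HasFDerivAt (fun z : EuclideanSpace ℝ (Fin n) => x + c • z)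
      (c • ContinuousLinearMap.id ℝ _) z := ((hasFDerivAt_id z).const_smul c).const_add x
    have h3 : HasFDerivAt (fun z => h (x + c • z)) _ z := h1.comp z h2
    refine h3.congr_fderiv ?_
    ext y
    simp
  have ha' : Continuous (pdir n i a) := (pdir_smooth ha i).continuous
  have hh' : Continuous (pdir n i h) := (pdir_smooth hh i).continuous
  have c1 := hh.continuous.comp hm.continuous
  have c2 := hh'.comp hm.continuous
  have hfd : ∀ z, fderiv ℝ (fun z => h (x + c • z)) z (EuclideanSpace.single i 1) =
      c * pdir n i h (x + c • z) := fun z => by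
    rw [(hd z).fderiv]; rfl
  have key := integral_mul_fderiv_eq_neg_fderiv_mul_of_integrable (μ := volume)
    (f := a) (g := fun z => h (x + c • z)) (v := EuclideanSpace.single i (1:ℝ)) ?_ ?_ ?_ ?_ ?_
  · simp only [hfd] at key
    rw [← integral_const_mul]
    refine Eq.trans ?_ key
    exact integral_congr_ae (Filter.Eventually.of_forall fun z => by simp only; ring)
  · exact (ha'.mul c1).integrable_of_hasCompactSupport ((cpt_pdir hac i).mul_right)
  · simp only [hfd]
    exact (ha.continuous.mul (c2.const_smul c)).integrable_of_hasCompactSupport hac.mul_right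
  · exact (ha.continuous.mul c1).integrable_of_hasCompactSupport hac.mul_right
  · exact fun z _ => ha.differentiable (by simp) z
  · exact fun z _ => (hd z).differentiableAt

lemma rot_shift {k : EuclideanSpace ℝ (Fin n) → ℝ} (hk : ContDiff ℝ (⊤ : ℕ∞) k)
    (x : EuclideanSpace ℝ (Fin n)) {c : ℝ} (hc : c ≠ 0) (i j : Fin n) :
    ∫ z, (eta n z * z j) * pdir n i k (x + c • z) =
      ∫ z, (eta n z * z i) * pdir n j k (x + c • z) := by
  refine mul_left_cancel₀ hc ?_
  rw [ibp_shift (etaz_smooth j) (etaz_cpt j) hk x c i,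
    ibp_shift (etaz_smooth i) (etaz_cpt i) hk x c j]
  simp only [etaz_pdir_symm _ i j]

/-- measure on the unit ball -/
def nuB (n : ℕ) : Measure (EuclideanSpace ℝ (Fin n)) := volume.restrict (Metric.closedBall 0 1)

instance nuB_finite : IsFiniteMeasure (nuB n) :=
  ⟨by rw [nuB, Measure.restrict_apply_univ]; exact (isCompact_closedBall 0 1).measure_lt_top⟩

/-- product measure -/
def nuP (n : ℕ) : Measure (ℝ × EuclideanSpace ℝ (Fin n)) :=
  (volume.restrict (Icc (0:ℝ) 1)).prod (nuB n)

instance nuP_finite : IsFiniteMeasure (nuP n) := by unfold nuP; infer_instance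

lemma nuB_integral {a h : EuclideanSpace ℝ (Fin n) → ℝ}
    (ha : ∀ z, z ∉ Metric.closedBall 0 1 → a z = 0) :
    ∫ z, a z * h z ∂(nuB n) = ∫ z, a z * h z := by
  rw [nuB]
  exact setIntegral_eq_integral_of_forall_compl_eq_zero fun z hz => by rw [ha z hz, zero_mul]

/-- kernel coefficients -/
def phiU (n : ℕ) (j : Fin n) (ζ : ℝ × EuclideanSpace ℝ (Fin n)) : ℝ := eta n ζ.2 * ζ.2 j

/-- shifts -/
def tauU (n : ℕ) (s : ℝ) (ζ : ℝ × EuclideanSpace ℝ (Fin n)) : EuclideanSpace ℝ (Fin n) :=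
  (ζ.1 * s) • ζ.2

lemma phiU_meas (j : Fin n) : Measurable (phiU n j) :=
  ((etaz_smooth j).continuous.comp continuous_snd).measurable

lemma tauU_meas (s : ℝ) : Measurable (tauU n s) := by
  unfold tauU
  have : Continuous (fun ζ : ℝ × EuclideanSpace ℝ (Fin n) => (ζ.1 * s) • ζ.2) := by fun_prop
  exact this.measurable

lemma phiU_bound (j : Fin n) (ζ : ℝ × EuclideanSpace ℝ (Fin n)) : |phiU n j ζ| ≤ 1 :=
  etaz_bound _ _

lemma rot_avg {k : EuclideanSpace ℝ (Fin n) → ℝ} (hk : ContDiff ℝ (⊤ : ℕ∞) k)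
    (hkc : HasCompactSupport k) {s : ℝ} (hs : s ≠ 0)
    (x : EuclideanSpace ℝ (Fin n)) (i j : Fin n) :
    shiftAvg (nuP n) (phiU n j) (tauU n s) (pdir n i k) x =
      shiftAvg (nuP n) (phiU n i) (tauU n s) (pdir n j k) x := by
  have hi := fun i j => shift_integrable (ν := nuP n) (tauU_meas s) (phiU_meas j) (phiU_bound j)
    (pdir_smooth hk i).continuous (cpt_pdir hkc i) x
  simp only [shiftAvg]
  have h1 := hi i j
  have h2 := hi j i
  simp only [nuP] at h1 h2 ⊢
  rw [integral_prod _ h1, integral_prod _ h2]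
  have hae : ∀ᵐ σ ∂(volume.restrict (Icc (0:ℝ) 1)), σ ≠ 0 := by
    refine ae_restrict_of_ae ?_
    exact Measure.ae_ne volume 0
  refine integral_congr_ae ?_
  filter_upwards [hae] with σ hσ
  simp only [phiU, tauU]
  rw [nuB_integral (a := fun z => eta n z * z j) fun z hz => by simp [eta_zero hz],
    nuB_integral (a := fun z => eta n z * z i) fun z hz => by simp [eta_zero hz]]
  exact rot_shift hk x (mul_ne_zero hσ hs) i j

lemma shiftAvg_sum {Z : Type*} [MeasurableSpace Z] {ν : Measure Z} [IsFiniteMeasure ν]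
    {τ : Z → EuclideanSpace ℝ (Fin n)} {φ : Z → ℝ} {M : ℝ} (hτ : Measurable τ) (hφ : Measurable φ)
    (hM : ∀ ζ, |φ ζ| ≤ M) {ι : Type*} (t : Finset ι) {h : ι → EuclideanSpace ℝ (Fin n) → ℝ}
    (hc : ∀ i, Continuous (h i)) (hs : ∀ i, HasCompactSupport (h i))
    (x : EuclideanSpace ℝ (Fin n)) :
    shiftAvg ν φ τ (fun y => ∑ i ∈ t, h i y) x = ∑ i ∈ t, shiftAvg ν φ τ (h i) x := by
  simp only [shiftAvg, Finset.mul_sum]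
  rw [integral_finsetSum]
  exact fun i _ => shift_integrable hτ hφ hM (hc i) (hs i) x

lemma ftc_avg {G : EuclideanSpace ℝ (Fin n) → ℝ} (hG : ContDiff ℝ (⊤ : ℕ∞) G)
    (hGc : HasCompactSupport G) (s : ℝ) (x : EuclideanSpace ℝ (Fin n)) :
    s * ∑ i, shiftAvg (nuP n) (phiU n i) (tauU n s) (pdir n i G) x =
      ∫ z, eta n z * (G (x + s • z) - G x) := by
  have hi := fun i => shift_integrable (ν := nuP n) (tauU_meas s) (phiU_meas i) (phiU_bound i)
    (pdir_smooth hG i).continuous (cpt_pdir hGc i) x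
  simp only [shiftAvg]
  rw [← integral_finsetSum _ fun i _ => hi i, ← integral_const_mul]
  have h2 := (integrable_finsetSum Finset.univ fun i _ => hi i).const_mul s
  simp only [nuP] at h2 ⊢
  rw [integral_prod_symm _ h2, ← nuB_integral (fun z hz => eta_zero hz)]
  refine integral_congr_ae (Filter.Eventually.of_forall fun z => ?_)
  simp only
  have hd : ∀ σ : ℝ, HasDerivAt (fun σ : ℝ => G (x + (σ * s) • z))
      (s * ∑ i, z i * pdir n i G (x + (σ * s) • z)) σ := fun σ => by
    have h1 : HasFDerivAt G (fderiv ℝ G (x + (σ * s) • z)) (x + (σ * s) • z) :=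
      (hG.differentiable (by simp) _).hasFDerivAt
    have h2 : HasDerivAt (fun σ : ℝ => x + (σ * s) • z) (s • z) σ := by
      have := ((hasDerivAt_mul_const (x := σ) s).smul_const z).const_add x
      exact this
    have := h1.comp_hasDerivAt σ h2
    refine this.congr_deriv ?_
    rw [map_smul, fderiv_apply_sum]
    rfl
  have hcont : Continuous fun σ : ℝ => s * ∑ i, z i * pdir n i G (x + (σ * s) • z) := by
    have := fun i => (pdir_smooth hG i).continuous
    fun_prop
  have ftc := intervalIntegral.integral_eq_sub_of_hasDerivAt (a := 0) (b := 1) (fun σ _ => hd σ)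
    (hcont.intervalIntegrable 0 1)
  rw [intervalIntegral.integral_of_le zero_le_one, ← integral_Icc_eq_integral_Ioc] at ftc
  simp only [one_mul, zero_mul, zero_smul, add_zero] at ftc
  rw [← ftc, ← integral_const_mul]
  refine integral_congr_ae (Filter.Eventually.of_forall fun σ => ?_)
  simp only [phiU, tauU, Finset.mul_sum]
  exact Finset.sum_congr rfl fun i _ => by ring

lemma tauU_le {s : ℝ} (hs : 0 < s) : ∀ᵐ ζ ∂(nuP n), ‖tauU n s ζ‖ ≤ s := by
  have h1 : nuP n = (volume.prod volume).restrict (Icc (0:ℝ) 1 ×ˢ Metric.closedBall 0 1) := by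
    rw [nuP, nuB, Measure.prod_restrict]
  rw [h1]
  filter_upwards [ae_restrict_mem (measurableSet_Icc.prod Metric.isClosed_closedBall.measurableSet)]
    with ζ hζ
  obtain ⟨⟨h1, h2⟩, h3⟩ := hζ
  have h3 : ‖ζ.2‖ ≤ 1 := by simpa using h3
  rw [tauU, norm_smul, norm_mul, Real.norm_of_nonneg h1, Real.norm_of_nonneg hs.le]
  have : ζ.1 * s ≤ 1 * s := mul_le_mul_of_nonneg_right h2 hs.le
  calc ζ.1 * s * ‖ζ.2‖ ≤ 1 * s * 1 := mul_le_mul this h3 (norm_nonneg _) (by linarith)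
    _ = s := by ring

lemma tauB_le {s : ℝ} (hs : 0 < s) :
    ∀ᵐ z ∂(nuB n), ‖(fun z : EuclideanSpace ℝ (Fin n) => s • z) z‖ ≤ s := by
  rw [nuB]
  filter_upwards [ae_restrict_mem (Metric.isClosed_closedBall.measurableSet)] with z hz
  have h3 : ‖z‖ ≤ 1 := by simpa using hz
  rw [norm_smul, Real.norm_of_nonneg hs.le]
  nlinarith

lemma eta_pdir_zero {z : EuclideanSpace ℝ (Fin n)} (hz : z ∉ Metric.closedBall 0 1) (i : Fin n) :
    pdir n i (eta n) z = 0 := by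
  have : (eta n) =ᶠ[nhds z] fun _ => 0 := by
    filter_upwards [Metric.isClosed_closedBall.isOpen_compl.mem_nhds hz] with y hy
    exact eta_zero hy
  rw [pdir, this.fderiv_eq]
  simp

lemma lapl_sum {ι : Type*} (t : Finset ι) {u : ι → EuclideanSpace ℝ (Fin n) → ℝ}
    (hu : ∀ i, ContDiff ℝ (⊤ : ℕ∞) (u i)) (x : EuclideanSpace ℝ (Fin n)) :
    lapl n (fun y => ∑ i ∈ t, u i y) x = ∑ i ∈ t, lapl n (u i) x := by
  simp only [lapl]
  have hd : ∀ {g : EuclideanSpace ℝ (Fin n) → ℝ}, ContDiff ℝ (⊤ : ℕ∞) g → ∀ y,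
    DifferentiableAt ℝ g y := fun hg y => hg.differentiable (by simp) y
  have h1 : ∀ j, pdir n j (fun y => ∑ i ∈ t, u i y) = fun y => ∑ i ∈ t, pdir n j (u i) y :=
    fun j => funext fun y => pdir_sum t j fun i _ => hd (hu i) y
  rw [Finset.sum_comm]
  refine Finset.sum_congr rfl fun j _ => ?_
  rw [h1, pdir_sum t j fun i _ => hd (pdir_smooth (hu i) j) x]

lemma shift_const_mul {Z : Type*} [MeasurableSpace Z] {ν : Measure Z}
    {τ : Z → EuclideanSpace ℝ (Fin n)} {φ : Z → ℝ} (c : ℝ)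
    (h : EuclideanSpace ℝ (Fin n) → ℝ) (x : EuclideanSpace ℝ (Fin n)) :
    shiftAvg ν (fun ζ => c * φ ζ) τ h x = c * shiftAvg ν φ τ h x := by
  simp only [shiftAvg, mul_assoc, integral_const_mul]

lemma lapl_avg {F : Fin n → EuclideanSpace ℝ (Fin n) → ℝ} (hF : ∀ j, ContDiff ℝ (⊤ : ℕ∞) (F j))
    (hFc : ∀ j, HasCompactSupport (F j)) {s : ℝ} (hs : s ≠ 0) (x : EuclideanSpace ℝ (Fin n)) :
    s * ∑ j, shiftAvg (nuP n) (phiU n j) (tauU n s) (lapl n (F j)) x =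
      - (∑ j, s⁻¹ * shiftAvg (nuB n) (pdir n j (eta n)) (fun z => s • z) (F j) x) -
      (∫ z, eta n z) * ∑ j, pdir n j (F j) x := by
  have hS := fun j i => pdir_smooth (hF j) i
  have hC := fun j i => cpt_pdir (hFc j) i
  set G : EuclideanSpace ℝ (Fin n) → ℝ := fun y => ∑ j, pdir n j (F j) y with hG
  have hGs : ContDiff ℝ (⊤ : ℕ∞) G := ContDiff.sum fun j _ => hS j j
  have hGc : HasCompactSupport G := by
    obtain ⟨K, hK, hK2⟩ : ∃ K : Set (EuclideanSpace ℝ (Fin n)), IsCompact K ∧ ∀ y ∉ K, G y = 0 := by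
      refine ⟨⋃ j, tsupport (pdir n j (F j)), isCompact_iUnion fun j => hC j j, fun y hy => ?_⟩
      simp only [mem_iUnion, not_exists] at hy
      exact Finset.sum_eq_zero fun j _ => image_eq_zero_of_notMem_tsupport (hy j)
    exact HasCompactSupport.intro hK hK2
  have e1 : ∑ j, shiftAvg (nuP n) (phiU n j) (tauU n s) (lapl n (F j)) x =
      ∑ i, shiftAvg (nuP n) (phiU n i) (tauU n s) (pdir n i G) x := by
    have a1 : ∀ j, shiftAvg (nuP n) (phiU n j) (tauU n s) (lapl n (F j)) x =
        ∑ i, shiftAvg (nuP n) (phiU n i) (tauU n s) (pdir n i (pdir n j (F j))) x := fun j => by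
      have := shiftAvg_sum (ν := nuP n) (tauU_meas s) (phiU_meas j) (phiU_bound j) Finset.univ
        (h := fun i => pdir n i (pdir n i (F j)))
        (fun i => (pdir_smooth (hS j i) i).continuous) (fun i => cpt_pdir (hC j i) i) x
      refine Eq.trans this (Finset.sum_congr rfl fun i _ => ?_)
      rw [rot_avg (hS j i) (hC j i) hs x i j]
      congr 1
      funext y
      exact pdir_comm (hF j) _ _ _
    have a2 : ∀ i, shiftAvg (nuP n) (phiU n i) (tauU n s) (pdir n i G) x =
        ∑ j, shiftAvg (nuP n) (phiU n i) (tauU n s) (pdir n i (pdir n j (F j))) x := fun i => by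
      rw [← shiftAvg_sum (ν := nuP n) (tauU_meas s) (phiU_meas i) (phiU_bound i) Finset.univ
        (h := fun j => pdir n i (pdir n j (F j)))
        (fun j => (pdir_smooth (hS j j) i).continuous) (fun j => cpt_pdir (hC j j) i) x]
      congr 1
      funext y
      exact pdir_sum _ i fun j _ => (hS j j).differentiable (by simp) y
    simp only [a1, a2]
    exact Finset.sum_comm
  rw [e1, ftc_avg hGs hGc s x]
  have hm : Continuous (fun z : EuclideanSpace ℝ (Fin n) => x + s • z) := by fun_prop
  have i1 : ∀ j, Integrable fun z => eta n z * pdir n j (F j) (x + s • z) := fun j =>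
    (eta_smooth.continuous.mul ((hS j j).continuous.comp hm)).integrable_of_hasCompactSupport
      eta_cpt.mul_right
  have i2 : Integrable (eta n) := eta_smooth.continuous.integrable_of_hasCompactSupport eta_cpt
  have e2 : ∀ z, eta n z * (G (x + s • z) - G x) =
      (∑ j, eta n z * pdir n j (F j) (x + s • z)) - eta n z * G x := fun z => by
    rw [mul_sub, hG, Finset.mul_sum]
  simp only [e2]
  rw [integral_sub (integrable_finsetSum _ fun j _ => i1 j) (i2.mul_const _), integral_mul_const,
    integral_finsetSum _ fun j _ => i1 j, ← Finset.sum_neg_distrib]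
  congr 1
  refine Finset.sum_congr rfl fun j _ => ?_
  rw [shiftAvg, nuB_integral fun z hz => eta_pdir_zero hz j]
  have := ibp_shift eta_smooth eta_cpt (hF j) x s j
  field_simp
  linarith

lemma parametrix (n : ℕ) : ∃ C : ℝ, 0 < C ∧ ∀ s : ℝ, 0 < s →
    ∀ F : Fin n → EuclideanSpace ℝ (Fin n) → ℝ, (∀ j, ContDiff ℝ (⊤ : ℕ∞) (F j)) →
    (∀ j, HasCompactSupport (F j)) → ∃ u R : EuclideanSpace ℝ (Fin n) → ℝ,
      ContDiff ℝ (⊤ : ℕ∞) u ∧ ContDiff ℝ (⊤ : ℕ∞) R ∧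
      (∀ x, lapl n u x = R x - ∑ j, pdir n j (F j) x) ∧
      (∀ x, (∀ y, ‖y - x‖ ≤ s → ∀ j, F j y = 0) → u x = 0 ∧ R x = 0) ∧
      ∀ (p : EuclideanSpace ℝ (Fin n) → ℝ) (D : ℝ), (∀ x, 0 ≤ p x) → 0 ≤ D →
        (Continuous fun x => p x * ∑ j, F j x ^ 2) →
        (∀ x y, ‖y - x‖ ≤ s → (∃ j, F j y ≠ 0) → p x ≤ D * p y) →
        ∫ x, p x * u x ^ 2 ≤ C * s ^ 2 * D * ∫ x, p x * ∑ j, F j x ^ 2 ∧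
        ∫ x, p x * R x ^ 2 ≤ C * s⁻¹ ^ 2 * D * ∫ x, p x * ∑ j, F j x ^ 2 := by
  set m : ℝ := ∫ z, eta n z with hm
  have hm0 : 0 < m := eta_int_pos
  have hbd : ∀ j, ∃ M, ∀ z, |pdir n j (eta n) z| ≤ M := fun j =>
    bounded_of_cpt (pdir_smooth eta_smooth j).continuous (cpt_pdir eta_cpt j)
  choose M hM using hbd
  set C1 := (nuP n).real univ ^ 2 * m⁻¹ ^ 2 * n with hC1
  set C2 := (nuB n).real univ ^ 2 * (m⁻¹ ^ 2 * ∑ j, M j ^ 2) with hC2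
  have hC10 : 0 ≤ C1 := by positivity
  have hC20 : 0 ≤ C2 := by positivity
  refine ⟨C1 + C2 + 1, by linarith, fun s hs F hF hFc => ?_⟩
  have mB : Measurable (fun z : EuclideanSpace ℝ (Fin n) => s • z) := measurable_id.const_smul s
  have mphi : ∀ j, Measurable (fun ζ => s / m * phiU n j ζ) := fun j => (phiU_meas j).const_mul _
  have bphi : ∀ j ζ, |s / m * phiU n j ζ| ≤ s / m := fun j ζ => by
    rw [abs_mul, abs_of_pos (div_pos hs hm0)]
    exact mul_le_of_le_one_right (by positivity) (phiU_bound j ζ)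
  have mpsi : ∀ j, Measurable (fun z => -(s⁻¹ / m) * pdir n j (eta n) z) := fun j =>
    (pdir_smooth eta_smooth j).continuous.measurable.const_mul _
  have bpsi0 : ∀ j z, |-(s⁻¹ / m) * pdir n j (eta n) z| ≤ s⁻¹ / m * M j := fun j z => by
    rw [abs_mul, abs_neg, abs_of_pos (div_pos (inv_pos.2 hs) hm0)]
    exact mul_le_mul_of_nonneg_left (hM j z) (by positivity)
  have hMj0 : ∀ j, 0 ≤ M j := fun j => (abs_nonneg _).trans (hM j 0)
  have bpsi : ∀ j z, |-(s⁻¹ / m) * pdir n j (eta n) z| ≤ s⁻¹ / m * ∑ i, M i := fun j z =>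
    (bpsi0 j z).trans (mul_le_mul_of_nonneg_left
      (Finset.single_le_sum (fun i _ => hMj0 i) (Finset.mem_univ j)) (by positivity))
  set u : EuclideanSpace ℝ (Fin n) → ℝ := fun x =>
    ∑ j, shiftAvg (nuP n) (fun ζ => s / m * phiU n j ζ) (tauU n s) (F j) x with hu
  set R : EuclideanSpace ℝ (Fin n) → ℝ := fun x =>
    ∑ j, shiftAvg (nuB n) (fun z => -(s⁻¹ / m) * pdir n j (eta n) z) (fun z => s • z) (F j) x with hR
  have us := fun j => shift_contDiff (ν := nuP n) (tauU_meas s) (mphi j) (bphi j) (hF j) (hFc j)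
  refine ⟨u, R, ContDiff.sum fun j _ => us j,
    ContDiff.sum fun j _ => shift_contDiff mB (mpsi j) (bpsi j) (hF j) (hFc j), ?_, ?_, ?_⟩
  · intro x
    rw [hu, lapl_sum _ us]
    have := lapl_avg hF hFc hs.ne' x
    have e1 : ∀ j, lapl n (shiftAvg (nuP n) (fun ζ => s / m * phiU n j ζ) (tauU n s) (F j)) x =
        m⁻¹ * (s * shiftAvg (nuP n) (phiU n j) (tauU n s) (lapl n (F j)) x) := fun j => by
      rw [shift_lapl (tauU_meas s) (mphi j) (bphi j) (hF j) (hFc j), shift_const_mul]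
      ring
    simp only [e1, hR, shift_const_mul]
    rw [← Finset.mul_sum, ← Finset.mul_sum, this, mul_sub, ← mul_assoc, ← hm,
      inv_mul_cancel₀ hm0.ne', one_mul, mul_neg, Finset.mul_sum, ← Finset.sum_neg_distrib]
    congr 1
    exact Finset.sum_congr rfl fun j _ => by ring
  · intro x hx
    exact ⟨Finset.sum_eq_zero fun j _ => shift_zero (tauU_le hs) fun y hy => hx y hy j,
      Finset.sum_eq_zero fun j _ => shift_zero (tauB_le hs) fun y hy => hx y hy j⟩
  · intro p D hp hD hpc hpD
    have hI : 0 ≤ D * ∫ x, p x * ∑ j, F j x ^ 2 := mul_nonneg hD (integral_nonneg fun x =>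
      mul_nonneg (hp x) (Finset.sum_nonneg fun _ _ => sq_nonneg _))
    constructor
    · have := shift_weighted (ν := nuP n) (φ := fun j ζ => s / m * phiU n j ζ)
        (B := n * (s / m) ^ 2) (D := D) (tauU_meas s)
        (tauU_le hs) mphi bphi ?_ (fun j => (hF j).continuous) hFc hp (by positivity) hpc hpD
      · refine this.trans ?_
        have e : (nuP n).real univ ^ 2 * (n * (s / m) ^ 2) * D * (∫ x, p x * ∑ j, F j x ^ 2) =
          C1 * s ^ 2 * (D * ∫ x, p x * ∑ j, F j x ^ 2) := by rw [hC1]; ring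
        rw [e, mul_assoc _ D]
        refine mul_le_mul_of_nonneg_right ?_ hI
        exact mul_le_mul_of_nonneg_right (by linarith) (sq_nonneg _)
      · intro ζ
        calc ∑ j, (s / m * phiU n j ζ) ^ 2 ≤ ∑ j : Fin n, (s / m) ^ 2 :=
              Finset.sum_le_sum fun j _ => sq_le_sq' (abs_le.1 (bphi j ζ)).1 (abs_le.1 (bphi j ζ)).2
          _ = _ := by simp
    · have := shift_weighted (ν := nuB n) (φ := fun j z => -(s⁻¹ / m) * pdir n j (eta n) z)
        (B := ∑ j, (s⁻¹ / m * M j) ^ 2) (D := D) mB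
        (tauB_le hs) mpsi bpsi ?_ (fun j => (hF j).continuous) hFc hp
        (Finset.sum_nonneg fun _ _ => sq_nonneg _) hpc hpD
      · refine this.trans ?_
        have e : (nuB n).real univ ^ 2 * (∑ j, (s⁻¹ / m * M j) ^ 2) * D *
            (∫ x, p x * ∑ j, F j x ^ 2) =
          C2 * s⁻¹ ^ 2 * (D * ∫ x, p x * ∑ j, F j x ^ 2) := by
          have : ∑ j, (s⁻¹ / m * M j) ^ 2 = s⁻¹ ^ 2 * (m⁻¹ ^ 2 * ∑ j, M j ^ 2) := by
            rw [Finset.mul_sum, Finset.mul_sum]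
            exact Finset.sum_congr rfl fun j _ => by ring
          rw [hC2, this]; ring
        rw [e, mul_assoc _ D]
        refine mul_le_mul_of_nonneg_right ?_ hI
        exact mul_le_mul_of_nonneg_right (by linarith) (sq_nonneg _)
      · intro z
        exact Finset.sum_le_sum fun j _ =>
          sq_le_sq' (abs_le.1 (bpsi0 j z)).1 (abs_le.1 (bpsi0 j z)).2

lemma log_close {x y : EuclideanSpace ℝ (Fin n)} {d : ℝ} (hy : y ≠ 0) (hd : 0 ≤ d)
    (hd2 : d ≤ 1 / 2) (hxy : ‖y - x‖ ≤ d * ‖y‖) :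
    x ≠ 0 ∧ |Real.log ‖x‖ - Real.log ‖y‖| ≤ 2 * d := by
  have hy0 : 0 < ‖y‖ := norm_pos_iff.2 hy
  have h1 : ‖y‖ - ‖x‖ ≤ d * ‖y‖ := (norm_sub_norm_le y x).trans hxy
  have h2 : ‖x‖ - ‖y‖ ≤ d * ‖y‖ := (norm_sub_norm_le x y).trans (by rwa [norm_sub_rev])
  have hx0 : 0 < ‖x‖ := by nlinarith
  refine ⟨norm_pos_iff.1 hx0, ?_⟩
  rw [← Real.log_div hx0.ne' hy0.ne', abs_le]
  have h3 : ‖x‖ / ‖y‖ - 1 ≤ d := by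
    rw [sub_le_iff_le_add, div_le_iff₀ hy0]; linarith
  have h4 : -(2 * d) ≤ 1 - (‖x‖ / ‖y‖)⁻¹ := by
    rw [inv_div]
    have : ‖y‖ / ‖x‖ ≤ 1 + 2 * d := by
      rw [div_le_iff₀ hx0]
      nlinarith [mul_nonneg hd (norm_nonneg y), mul_nonneg hd (sub_nonneg.2 h1)]
    linarith
  have hp : 0 < ‖x‖ / ‖y‖ := div_pos hx0 hy0
  exact ⟨h4.trans (Real.one_sub_inv_le_log_of_pos hp), by
    linarith [Real.log_le_sub_one_of_pos hp]⟩

lemma psi_lip {t t' : ℝ} (ht : t < -4) (ht' : t' < -4) : |psi t - psi t'| ≤ |t - t'| := by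
  have := (convex_Iio (-4 : ℝ)).norm_image_sub_le_of_norm_hasDerivWithin_le (f := psi)
    (f' := fun t => 1 + 2 / t) (C := 1) (fun t ht => (psi_hasDerivAt ht).hasDerivWithinAt)
    (fun t ht => ?_) ht' ht
  · simpa using this
  · have h : t < -4 := ht
    have h1 : 2 / t ≤ 0 := div_nonpos_of_nonneg_of_nonpos (by norm_num) (by linarith)
    have h2 : -1 ≤ 2 / t := by rw [le_div_iff_of_neg (by linarith)]; linarith
    rw [Real.norm_eq_abs, abs_le]
    constructor <;> linarith

lemma om_compare {b t t' : ℝ} (hb : 1 ≤ b) (ht : t < -4) (ht' : t' < -4) (h : |t - t'| ≤ 1 / b) :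
    om n b t ≤ Real.exp (n + 2) * om n b t' := by
  rw [om, om, ← Real.exp_add, Real.exp_le_exp]
  have h1 := (psi_lip ht ht').trans h
  have h2 : b * |psi t - psi t'| ≤ 1 := by
    have := mul_le_mul_of_nonneg_left h1 (by linarith : 0 ≤ b)
    rwa [mul_one_div_cancel (by linarith)] at this
  have h3 : |t - t'| ≤ 1 := h.trans (by rw [div_le_one (by linarith)]; exact hb)
  have h4 : -(b * (psi t - psi t')) ≤ 1 := by
    refine le_trans ?_ h2
    rw [← mul_neg]
    exact mul_le_mul_of_nonneg_left (neg_le_abs _) (by linarith)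
  have h5 : (n : ℝ) * (-(t - t')) ≤ n * 1 :=
    mul_le_mul_of_nonneg_left ((neg_le_abs _).trans h3) (Nat.cast_nonneg n)
  linarith

lemma omr_continuousOn (b : ℝ) (c : ℕ) : ContinuousOn
    (fun x : EuclideanSpace ℝ (Fin n) => om n b (Real.log ‖x‖) * ‖x‖ ^ c) (UT n (-4)) :=
  (radial_continuousOn (om_continuousOn b)).mul (by fun_prop)

lemma omr_integrable (b : ℝ) (c : ℕ) {v : EuclideanSpace ℝ (Fin n) → ℝ} (hv : Adm n (-4) v) :
    Integrable (fun x : EuclideanSpace ℝ (Fin n) => om n b (Real.log ‖x‖) * ‖x‖ ^ c * v x) :=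
  integrable_mul_of (omr_continuousOn b c) hv.smooth.continuous hv.cpt hv.supp

lemma omr_continuous (b : ℝ) (c : ℕ) {v : EuclideanSpace ℝ (Fin n) → ℝ} (hv : Adm n (-4) v) :
    Continuous (fun x : EuclideanSpace ℝ (Fin n) => om n b (Real.log ‖x‖) * ‖x‖ ^ c * v x) := by
  refine continuous_of_tsupport fun x hx => ?_
  exact ((omr_continuousOn b c).continuousAt
    (isOpen_UT.mem_nhds (hv.supp (tsupport_mul_subset_right hx)))).mul hv.smooth.continuous.continuousAt

lemma Adm.sq {v : EuclideanSpace ℝ (Fin n) → ℝ} (hv : Adm n T v) : Adm n T (fun x => v x ^ 2) := by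
  simpa only [pow_two] using hv.mul hv

lemma Adm.sumsq {F : Fin n → EuclideanSpace ℝ (Fin n) → ℝ} (hF : ∀ j, Adm n T (F j)) :
    Adm n T (fun x => ∑ j, F j x ^ 2) := Adm.sum _ fun j _ => (hF j).sq

lemma one_scale (n : ℕ) : ∃ C : ℝ, 0 < C ∧ ∀ b : ℝ, 1 ≤ b → ∀ k : ℝ,
    ∀ F : Fin n → EuclideanSpace ℝ (Fin n) → ℝ, (∀ j, Adm n (-6) (F j)) →
    (∀ j, ∀ y ∈ tsupport (F j), |Real.log ‖y‖ + k| ≤ 1) →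
    ∃ u R : EuclideanSpace ℝ (Fin n) → ℝ, Adm n (-4) u ∧ Adm n (-4) R ∧
      (∀ x, lapl n u x = R x - ∑ j, pdir n j (F j) x) ∧
      (∀ x, u x ≠ 0 → |Real.log ‖x‖ + k| ≤ 2) ∧
      (∀ x, R x ≠ 0 → |Real.log ‖x‖ + k| ≤ 2) ∧
      b ^ 2 * ∫ x, om n b (Real.log ‖x‖) * u x ^ 2 ≤
        C * ∫ x, om n b (Real.log ‖x‖) * ‖x‖ ^ 2 * ∑ j, F j x ^ 2 ∧
      ∫ x, om n b (Real.log ‖x‖) * ‖x‖ ^ 4 * R x ^ 2 ≤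
        C * b ^ 2 * ∫ x, om n b (Real.log ‖x‖) * ‖x‖ ^ 2 * ∑ j, F j x ^ 2 := by
  obtain ⟨C, hC, H⟩ := parametrix n
  refine ⟨C * Real.exp (n + 2) * Real.exp 4 * 576, by positivity, fun b hb k F hF hk => ?_⟩
  have hb0 : 0 < b := by linarith
  set s := Real.exp (-k) / (8 * b) with hs
  have hs0 : 0 < s := by positivity
  obtain ⟨u, R, hu, hR, hlap, hzero, hest⟩ := H s hs0 F (fun j => (hF j).smooth) (fun j => (hF j).cpt)
  have he3 : Real.exp 1 < 3 := Real.exp_one_lt_d9.trans (by norm_num)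
  have hlow : ∀ y : EuclideanSpace ℝ (Fin n), y ≠ 0 → |Real.log ‖y‖ + k| ≤ 1 →
      Real.exp (-k) ≤ 3 * ‖y‖ ∧ ‖y‖ ≤ 3 * Real.exp (-k) := fun y hy h => by
    have hy0 : 0 < ‖y‖ := norm_pos_iff.2 hy
    obtain ⟨h1, h2⟩ := abs_le.1 h
    constructor
    · calc Real.exp (-k) ≤ Real.exp (1 + Real.log ‖y‖) := Real.exp_le_exp.2 (by linarith)
        _ = Real.exp 1 * ‖y‖ := by rw [Real.exp_add, Real.exp_log hy0]
        _ ≤ _ := mul_le_mul_of_nonneg_right he3.le hy0.le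
    · calc ‖y‖ = Real.exp (Real.log ‖y‖) := (Real.exp_log hy0).symm
        _ ≤ Real.exp (1 + -k) := Real.exp_le_exp.2 (by linarith)
        _ = Real.exp 1 * Real.exp (-k) := by rw [Real.exp_add]
        _ ≤ _ := mul_le_mul_of_nonneg_right he3.le (Real.exp_pos _).le
  -- geometry near the support
  have hgeo : ∀ x y : EuclideanSpace ℝ (Fin n), ‖y - x‖ ≤ s → (∃ j, y ∈ tsupport (F j)) →
      x ∈ UT n (-4) ∧ y ∈ UT n (-6) ∧ |Real.log ‖x‖ - Real.log ‖y‖| ≤ 1 / b ∧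
      |Real.log ‖x‖ + k| ≤ 2 := by
    rintro x y hxy ⟨j, hj⟩
    have hyU := (hF j).supp hj
    have hyk := hk j y hj
    obtain ⟨l1, _⟩ := hlow y hyU.1 hyk
    have hb1 : 1 / b ≤ 1 := by rw [div_le_one hb0]; exact hb
    have hsy : s ≤ 3 / 8 * (1 / b) * ‖y‖ := by
      rw [hs, div_le_iff₀ (by positivity)]
      calc _ ≤ _ := l1
        _ = _ := by field_simp
    obtain ⟨hx0, hlog⟩ := log_close (d := 3 / 8 * (1 / b)) hyU.1 (by positivity)
      (by linarith) (hxy.trans hsy)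
    have hlog' : |Real.log ‖x‖ - Real.log ‖y‖| ≤ 1 / b := hlog.trans (by
      have : 0 < 1 / b := by positivity
      linarith)
    obtain ⟨a1, a2⟩ := abs_le.1 hlog'
    obtain ⟨a3, a4⟩ := abs_le.1 hyk
    refine ⟨⟨hx0, by linarith [hyU.2]⟩, hyU, hlog', abs_le.2 ⟨by linarith, by linarith⟩⟩
  set K : Set (EuclideanSpace ℝ (Fin n)) := ⋃ j, tsupport (F j) with hK
  have hKc : IsCompact K := isCompact_iUnion fun j => (hF j).cpt
  have hout : ∀ x, x ∉ Metric.cthickening s K → u x = 0 ∧ R x = 0 := fun x hx => by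
    refine hzero x fun y hy j => ?_
    by_contra hne
    refine hx (Metric.mem_cthickening_of_dist_le x y s K
      (mem_iUnion.2 ⟨j, subset_tsupport _ hne⟩) ?_)
    rw [dist_eq_norm, norm_sub_rev]; exact hy
  have hin : ∀ x ∈ Metric.cthickening s K, x ∈ UT n (-4) ∧ |Real.log ‖x‖ + k| ≤ 2 := fun x hx => by
    rw [hKc.cthickening_eq_biUnion_closedBall hs0.le] at hx
    simp only [mem_iUnion] at hx
    obtain ⟨y, hyK, hxy⟩ := hx
    obtain ⟨j, hj⟩ := mem_iUnion.1 hyK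
    have := hgeo x y (by rwa [Metric.mem_closedBall, dist_comm, dist_eq_norm] at hxy) ⟨j, hj⟩
    exact ⟨this.1, this.2.2.2⟩
  have hadm : ∀ v : EuclideanSpace ℝ (Fin n) → ℝ, ContDiff ℝ (⊤ : ℕ∞) v →
      (∀ x, x ∉ Metric.cthickening s K → v x = 0) → Adm n (-4) v := fun v hv hv0 => by
    refine ⟨hv, HasCompactSupport.intro hKc.cthickening hv0, ?_⟩
    have : tsupport v ⊆ Metric.cthickening s K := closure_minimal (fun x hx => by
      by_contra h; exact hx (hv0 x h)) Metric.isClosed_cthickening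
    exact fun x hx => (hin x (this hx)).1
  refine ⟨u, R, hadm u hu fun x hx => (hout x hx).1, hadm R hR fun x hx => (hout x hx).2, hlap,
    fun x hx => ?_, fun x hx => ?_, ?_, ?_⟩
  · by_contra h
    exact hx (hout x fun h' => h (hin x h').2).1
  · by_contra h
    exact hx (hout x fun h' => h (hin x h').2).2
  · have hFF : Adm n (-4) (fun x => ∑ j, F j x ^ 2) := Adm.mono (by norm_num) (Adm.sumsq hF)
    have := (hest (fun x => om n b (Real.log ‖x‖) * ‖x‖ ^ 0) (Real.exp (n + 2))
      (fun x => mul_nonneg (om_pos _ _).le (by positivity)) (Real.exp_pos _).le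
      (omr_continuous b 0 hFF) ?_).1
    · simp only [pow_zero, mul_one] at this
      refine (mul_le_mul_of_nonneg_left this (sq_nonneg b)).trans ?_
      have hle : (b * s) ^ 2 * ∫ x, om n b (Real.log ‖x‖) * ∑ j, F j x ^ 2 ≤
          ∫ x, om n b (Real.log ‖x‖) * ‖x‖ ^ 2 * ∑ j, F j x ^ 2 := by
        rw [← integral_const_mul]
        have i0 := omr_integrable b 0 hFF
        simp only [pow_zero, mul_one] at i0
        refine integral_mono (i0.const_mul _) (omr_integrable b 2 hFF) fun x => ?_
        simp only
        by_cases hx : ∃ j, F j x ≠ 0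
        · obtain ⟨j, hj⟩ := hx
          have hj' := subset_tsupport _ hj
          obtain ⟨l1, _⟩ := hlow x ((hF j).supp hj').1 (hk j x hj')
          have : b * s ≤ ‖x‖ := by
            have : b * s = Real.exp (-k) / 8 := by rw [hs]; field_simp
            rw [this]; linarith [norm_nonneg x]
          have h2 : (b * s) ^ 2 ≤ ‖x‖ ^ 2 := pow_le_pow_left₀ (by positivity) this 2
          have h3 : 0 ≤ om n b (Real.log ‖x‖) * ∑ j, F j x ^ 2 :=
            mul_nonneg (om_pos _ _).le (Finset.sum_nonneg fun _ _ => sq_nonneg _)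
          calc _ ≤ ‖x‖ ^ 2 * (om n b (Real.log ‖x‖) * ∑ j, F j x ^ 2) :=
                mul_le_mul_of_nonneg_right h2 h3
            _ = _ := by ring
        · push Not at hx
          simp [hx]
      set I := ∫ x, om n b (Real.log ‖x‖) * ∑ j, F j x ^ 2
      have hI2 : 0 ≤ ∫ x, om n b (Real.log ‖x‖) * ‖x‖ ^ 2 * ∑ j, F j x ^ 2 :=
        integral_nonneg fun x => mul_nonneg (mul_nonneg (om_pos _ _).le (sq_nonneg _))
          (Finset.sum_nonneg fun _ _ => sq_nonneg _)
      calc b ^ 2 * (C * s ^ 2 * Real.exp (n + 2) * I)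
          = C * Real.exp (n + 2) * ((b * s) ^ 2 * I) := by ring
        _ ≤ C * Real.exp (n + 2) * ∫ x, om n b (Real.log ‖x‖) * ‖x‖ ^ 2 * ∑ j, F j x ^ 2 :=
            mul_le_mul_of_nonneg_left hle (by positivity)
        _ ≤ _ := by
            refine mul_le_mul_of_nonneg_right ?_ hI2
            rw [mul_assoc (C * _)]
            refine le_mul_of_one_le_right (by positivity) ?_
            have := Real.one_le_exp (show (0:ℝ) ≤ 4 by norm_num)
            linarith
    · rintro x y hxy ⟨j, hj⟩
      obtain ⟨g1, g2, g3, g4⟩ := hgeo x y hxy ⟨j, subset_tsupport _ hj⟩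
      simp only [pow_zero, mul_one]
      exact om_compare hb g1.2 (by linarith [g2.2]) g3
  · have hFF : Adm n (-4) (fun x => ∑ j, F j x ^ 2) := Adm.mono (by norm_num) (Adm.sumsq hF)
    have := (hest (fun x => om n b (Real.log ‖x‖) * ‖x‖ ^ 4) (Real.exp (n + 2) * Real.exp 4)
      (fun x => mul_nonneg (om_pos _ _).le (by positivity)) (by positivity)
      (omr_continuous b 4 hFF) ?_).2
    · refine this.trans ?_
      have hle : s⁻¹ ^ 2 * ∫ x, om n b (Real.log ‖x‖) * ‖x‖ ^ 4 * ∑ j, F j x ^ 2 ≤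
          576 * b ^ 2 * ∫ x, om n b (Real.log ‖x‖) * ‖x‖ ^ 2 * ∑ j, F j x ^ 2 := by
        rw [← integral_const_mul, ← integral_const_mul]
        refine integral_mono ((omr_integrable b 4 hFF).const_mul _)
          ((omr_integrable b 2 hFF).const_mul _) fun x => ?_
        simp only
        by_cases hx : ∃ j, F j x ≠ 0
        · obtain ⟨j, hj⟩ := hx
          have hj' := subset_tsupport _ hj
          obtain ⟨_, l1⟩ := hlow x ((hF j).supp hj').1 (hk j x hj')
          have : s⁻¹ * ‖x‖ ≤ 24 * b := by
            rw [inv_mul_le_iff₀ hs0]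
            have : s * (24 * b) = 3 * Real.exp (-k) := by rw [hs]; field_simp; norm_num
            rw [this]; exact l1
          have h2 : (s⁻¹ * ‖x‖) ^ 2 ≤ (24 * b) ^ 2 := pow_le_pow_left₀ (by positivity) this 2
          have h3 : 0 ≤ om n b (Real.log ‖x‖) * ‖x‖ ^ 2 * ∑ j, F j x ^ 2 :=
            mul_nonneg (mul_nonneg (om_pos _ _).le (sq_nonneg _))
              (Finset.sum_nonneg fun _ _ => sq_nonneg _)
          calc _ = (s⁻¹ * ‖x‖) ^ 2 * (om n b (Real.log ‖x‖) * ‖x‖ ^ 2 * ∑ j, F j x ^ 2) := by ring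
            _ ≤ (24 * b) ^ 2 * (om n b (Real.log ‖x‖) * ‖x‖ ^ 2 * ∑ j, F j x ^ 2) :=
                mul_le_mul_of_nonneg_right h2 h3
            _ = _ := by ring
        · push Not at hx
          simp [hx]
      calc _ = C * (Real.exp (n + 2) * Real.exp 4) *
            (s⁻¹ ^ 2 * ∫ x, om n b (Real.log ‖x‖) * ‖x‖ ^ 4 * ∑ j, F j x ^ 2) := by ring
        _ ≤ C * (Real.exp (n + 2) * Real.exp 4) *
            (576 * b ^ 2 * ∫ x, om n b (Real.log ‖x‖) * ‖x‖ ^ 2 * ∑ j, F j x ^ 2) :=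
              mul_le_mul_of_nonneg_left hle (by positivity)
        _ = _ := by ring
    · rintro x y hxy ⟨j, hj⟩
      obtain ⟨g1, g2, g3, g4⟩ := hgeo x y hxy ⟨j, subset_tsupport _ hj⟩
      have c1 := om_compare (n := n) hb g1.2 (by linarith [g2.2] : Real.log ‖y‖ < -4) g3
      have hx0 : 0 < ‖x‖ := norm_pos_iff.2 g1.1
      have hy0 : 0 < ‖y‖ := norm_pos_iff.2 g2.1
      have hb1 : 1 / b ≤ 1 := by rw [div_le_one hb0]; exact hb
      have c2 : ‖x‖ ≤ Real.exp 1 * ‖y‖ := by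
        calc ‖x‖ = Real.exp (Real.log ‖x‖) := (Real.exp_log hx0).symm
          _ ≤ Real.exp (1 + Real.log ‖y‖) := Real.exp_le_exp.2 (by linarith [(abs_le.1 g3).2])
          _ = _ := by rw [Real.exp_add, Real.exp_log hy0]
      have c3 : ‖x‖ ^ 4 ≤ Real.exp 4 * ‖y‖ ^ 4 := by
        calc ‖x‖ ^ 4 ≤ (Real.exp 1 * ‖y‖) ^ 4 := pow_le_pow_left₀ hx0.le c2 4
          _ = _ := by rw [mul_pow, ← Real.exp_nat_mul]; norm_num
      calc om n b (Real.log ‖x‖) * ‖x‖ ^ 4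
          ≤ (Real.exp (n + 2) * om n b (Real.log ‖y‖)) * (Real.exp 4 * ‖y‖ ^ 4) :=
            mul_le_mul c1 c3 (by positivity) (mul_nonneg (Real.exp_pos _).le (om_pos _ _).le)
        _ = _ := by ring

/-- dyadic cutoff -/
def chi (t : ℝ) : ℝ := Real.smoothTransition (t + 1) - Real.smoothTransition t

lemma chi_smooth : ContDiff ℝ (⊤ : ℕ∞) chi :=
  (Real.smoothTransition.contDiff.comp (contDiff_id.add contDiff_const)).sub
    Real.smoothTransition.contDiff

lemma chi_sq_le (t : ℝ) : chi t ^ 2 ≤ 1 := by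
  have h1 := Real.smoothTransition.nonneg (t + 1)
  have h2 := Real.smoothTransition.nonneg t
  have h3 := Real.smoothTransition.le_one (t + 1)
  have h4 := Real.smoothTransition.le_one t
  rw [sq_le_one_iff_abs_le_one, abs_le, chi]
  constructor <;> linarith

lemma chi_supp {t : ℝ} (ht : 1 ≤ |t|) : chi t = 0 := by
  rw [chi]
  rcases le_abs.1 ht with h | h
  · rw [Real.smoothTransition.one_of_one_le h, Real.smoothTransition.one_of_one_le (by linarith),
      sub_self]
  · rw [Real.smoothTransition.zero_of_nonpos (by linarith),
      Real.smoothTransition.zero_of_nonpos (by linarith), sub_self]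

lemma chi_sum {t : ℝ} {N : ℕ} (ht : t ≤ 0) (hN : 1 ≤ t + N) :
    ∑ k ∈ Finset.range N, chi (t + k) = 1 := by
  have h : ∀ k : ℕ, chi (t + k) = (fun k : ℕ => Real.smoothTransition (t + k)) (k + 1) -
      (fun k : ℕ => Real.smoothTransition (t + k)) k := fun k => by
    simp only [chi]; push_cast; ring_nf
  simp only [h]
  rw [Finset.sum_range_sub (fun k : ℕ => Real.smoothTransition (t + k))]
  simp [Real.smoothTransition.one_of_one_le hN, Real.smoothTransition.zero_of_nonpos ht]

lemma card_near (t : ℝ) (N : ℕ) :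
    ((Finset.range N).filter fun k : ℕ => |t + k| ≤ 2).card ≤ 5 := by
  set A := (Finset.range N).filter fun k : ℕ => |t + k| ≤ 2 with hA
  rcases A.eq_empty_or_nonempty with h | h
  · simp [h]
  · set m := A.min' h
    have hm : |t + m| ≤ 2 := (Finset.mem_filter.1 (A.min'_mem h)).2
    have : A ⊆ Finset.Icc m (m + 4) := fun k hk => by
      have h1 : |t + k| ≤ 2 := (Finset.mem_filter.1 hk).2
      refine Finset.mem_Icc.2 ⟨A.min'_le k hk, ?_⟩
      have : (k : ℝ) ≤ m + 4 := by linarith [(abs_le.1 h1).2, (abs_le.1 hm).1]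
      exact_mod_cast this
    refine (Finset.card_le_card this).trans ?_
    rw [Nat.card_Icc]
    lia

lemma sum_near_sq {t : ℝ} {N : ℕ} {a : ℕ → ℝ} (ha : ∀ k : ℕ, a k ≠ 0 → |t + k| ≤ 2) :
    (∑ k ∈ Finset.range N, a k) ^ 2 ≤ 5 * ∑ k ∈ Finset.range N, a k ^ 2 := by
  classical
  have e1 : ∑ k ∈ (Finset.range N).filter (fun k : ℕ => |t + k| ≤ 2), a k =
      ∑ k ∈ Finset.range N, a k := Finset.sum_filter_of_ne fun k _ hk => ha k hk
  have e2 : ∑ k ∈ (Finset.range N).filter (fun k : ℕ => |t + k| ≤ 2), a k ^ 2 ≤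
      ∑ k ∈ Finset.range N, a k ^ 2 :=
    Finset.sum_le_sum_of_subset_of_nonneg (Finset.filter_subset _ _) fun _ _ _ => sq_nonneg _
  rw [← e1]
  refine sq_sum_le_card_mul_sum_sq.trans ?_
  have := card_near t N
  have h5 : (((Finset.range N).filter (fun k : ℕ => |t + k| ≤ 2)).card : ℝ) ≤ 5 := by
    exact_mod_cast this
  exact mul_le_mul h5 e2 (Finset.sum_nonneg fun _ _ => sq_nonneg _) (by norm_num)

lemma chi_sq_sum (t : ℝ) (N : ℕ) : ∑ k ∈ Finset.range N, chi (t + k) ^ 2 ≤ 5 := by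
  classical
  have e1 : ∑ k ∈ (Finset.range N).filter (fun k : ℕ => |t + k| ≤ 2), chi (t + k) ^ 2 =
      ∑ k ∈ Finset.range N, chi (t + k) ^ 2 := Finset.sum_filter_of_ne fun k _ hk => by
    by_contra h
    exact hk (by rw [chi_supp (by linarith [not_le.1 h])]; norm_num)
  rw [← e1]
  refine (Finset.sum_le_card_nsmul _ _ 1 fun k _ => chi_sq_le _).trans ?_
  have := card_near t N
  simp only [nsmul_eq_mul, mul_one]
  exact_mod_cast this

lemma div_correct (n : ℕ) : ∃ C : ℝ, 0 < C ∧ ∀ b : ℝ, 1 ≤ b →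
    ∀ f : Fin n → EuclideanSpace ℝ (Fin n) → ℝ, (∀ j, Adm n (-6) (f j)) →
    ∃ w : EuclideanSpace ℝ (Fin n) → ℝ, Adm n (-4) w ∧
      b ^ 2 * ∫ x, om n b (Real.log ‖x‖) * w x ^ 2 ≤
        C * ∫ x, om n b (Real.log ‖x‖) * ∑ j, f j x ^ 2 ∧
      ∫ x, om n b (Real.log ‖x‖) * (‖x‖ ^ 2 * lapl n w x + ‖x‖ * ∑ j, pdir n j (f j) x) ^ 2 ≤
        C * b ^ 2 * ∫ x, om n b (Real.log ‖x‖) * ∑ j, f j x ^ 2 := by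
  obtain ⟨C, hC, H⟩ := one_scale n
  refine ⟨50 * C + 2, by positivity, fun b hb f hf => ?_⟩
  have hff : Adm n (-4) (fun x => ∑ j, f j x ^ 2) := Adm.mono (by norm_num) (Adm.sumsq hf)
  have hff0 : ∀ x, 0 ≤ ∑ j, f j x ^ 2 := fun x => Finset.sum_nonneg fun _ _ => sq_nonneg _
  -- lower bound for the logarithm on the support
  obtain ⟨N, hN⟩ : ∃ N : ℕ, ∀ j, ∀ x ∈ tsupport (f j), 1 ≤ Real.log ‖x‖ + N := by
    have : ∀ j, ∃ m : ℝ, ∀ x ∈ tsupport (f j), m ≤ Real.log ‖x‖ := fun j => by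
      have hc : ContinuousOn (fun x : EuclideanSpace ℝ (Fin n) => Real.log ‖x‖) (tsupport (f j)) :=
        fun x hx => (log_norm_continuousAt ((hf j).supp hx).1).continuousWithinAt
      obtain ⟨m, hm⟩ := ((hf j).cpt.image_of_continuousOn hc).bddBelow
      exact ⟨m, fun x hx => hm (mem_image_of_mem _ hx)⟩
    choose m hm using this
    obtain ⟨N, hN⟩ := exists_nat_ge (1 + ∑ j, |m j|)
    refine ⟨N, fun j x hx => ?_⟩
    have h1 := hm j x hx
    have h2 : |m j| ≤ ∑ j, |m j| :=
      Finset.single_le_sum (f := fun j => |m j|) (fun i _ => abs_nonneg _) (Finset.mem_univ j)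
    linarith [neg_abs_le (m j)]
  set F : ℕ → Fin n → EuclideanSpace ℝ (Fin n) → ℝ := fun k j x =>
    (chi (Real.log ‖x‖ + k) * ‖x‖⁻¹) * f j x with hFdef
  have hF : ∀ k j, Adm n (-6) (F k j) := fun k j => (hf j).mul_contDiffAt fun x hx => by
    refine ContDiffAt.mul ?_ ((contDiffAt_norm ℝ hx.1).inv (norm_ne_zero_iff.2 hx.1))
    exact chi_smooth.contDiffAt.comp x ((log_norm_contDiffAt hx.1).add contDiffAt_const)
  have hFk : ∀ k j, ∀ y ∈ tsupport (F k j), |Real.log ‖y‖ + k| ≤ 1 := fun k j y hy => by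
    by_contra h
    refine notMem_tsupport_iff_eventuallyEq.2 ?_ hy
    have hc : ContinuousAt (fun x : EuclideanSpace ℝ (Fin n) => |Real.log ‖x‖ + k|) y :=
      ((log_norm_continuousAt ((hF k j).supp hy).1).add continuousAt_const).abs
    filter_upwards [hc.eventually (lt_mem_nhds (not_le.1 h))] with x hx
    simp only [hFdef, chi_supp (le_of_lt hx), zero_mul, Pi.zero_apply]
  choose u R hu hR hlap hus hRs hue hRe using fun k : ℕ => H b hb k (F k) (hF k) (hFk k)
  set I := ∫ x, om n b (Real.log ‖x‖) * ∑ j, f j x ^ 2 with hI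
  have hI0 : 0 ≤ I := integral_nonneg fun x => mul_nonneg (om_pos _ _).le (hff0 x)
  have iff0 : Integrable fun x => om n b (Real.log ‖x‖) * ∑ j, f j x ^ 2 := by
    have := omr_integrable b 0 hff
    simpa only [pow_zero, mul_one] using this
  have hFF : ∀ k, Adm n (-4) (fun x => ∑ j, F k j x ^ 2) := fun k =>
    Adm.mono (by norm_num) (Adm.sumsq (hF k))
  have hsumF : ∑ k ∈ Finset.range N, ∫ x, om n b (Real.log ‖x‖) * ‖x‖ ^ 2 * ∑ j, F k j x ^ 2 ≤
      5 * I := by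
    rw [← integral_finsetSum _ fun k _ => omr_integrable b 2 (hFF k), hI, ← integral_const_mul]
    refine integral_mono (integrable_finsetSum _ fun k _ => omr_integrable b 2 (hFF k))
      (iff0.const_mul _) fun x => ?_
    simp only
    have e : ∀ k, ∑ j, F k j x ^ 2 = chi (Real.log ‖x‖ + k) ^ 2 * (‖x‖⁻¹ ^ 2 * ∑ j, f j x ^ 2) :=
      fun k => by
        simp only [hFdef, Finset.mul_sum]
        exact Finset.sum_congr rfl fun j _ => by ring
    simp only [e]
    have e2 : ∑ k ∈ Finset.range N, om n b (Real.log ‖x‖) * ‖x‖ ^ 2 *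
        (chi (Real.log ‖x‖ + k) ^ 2 * (‖x‖⁻¹ ^ 2 * ∑ j, f j x ^ 2)) =
        (∑ k ∈ Finset.range N, chi (Real.log ‖x‖ + k) ^ 2) *
          ((‖x‖ * ‖x‖⁻¹) ^ 2 * (om n b (Real.log ‖x‖) * ∑ j, f j x ^ 2)) := by
      rw [Finset.sum_mul]
      exact Finset.sum_congr rfl fun j _ => by ring
    rw [e2]
    have h1 : (‖x‖ * ‖x‖⁻¹) ^ 2 ≤ 1 := by
      by_cases hx : ‖x‖ = 0
      · simp [hx]
      · rw [mul_inv_cancel₀ hx]; norm_num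
    have h2 : 0 ≤ om n b (Real.log ‖x‖) * ∑ j, f j x ^ 2 := mul_nonneg (om_pos _ _).le (hff0 x)
    refine mul_le_mul (chi_sq_sum _ _) (mul_le_of_le_one_left h2 h1) (by positivity) (by norm_num)
  set w : EuclideanSpace ℝ (Fin n) → ℝ := fun x => ∑ k ∈ Finset.range N, u k x with hw
  set Rt : EuclideanSpace ℝ (Fin n) → ℝ := fun x => ∑ k ∈ Finset.range N, R k x with hRt
  have hwA : Adm n (-4) w := Adm.sum _ fun k _ => hu k
  have hRA : Adm n (-4) Rt := Adm.sum _ fun k _ => hR k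
  refine ⟨w, hwA, ?_, ?_⟩
  · have iu : ∀ k, Integrable fun x => om n b (Real.log ‖x‖) * u k x ^ 2 := fun k => by
      have := omr_integrable b 0 (hu k).sq
      simpa only [pow_zero, mul_one] using this
    have iw : Integrable fun x => om n b (Real.log ‖x‖) * w x ^ 2 := by
      have := omr_integrable b 0 hwA.sq
      simpa only [pow_zero, mul_one] using this
    have h1 : ∫ x, om n b (Real.log ‖x‖) * w x ^ 2 ≤
        5 * ∑ k ∈ Finset.range N, ∫ x, om n b (Real.log ‖x‖) * u k x ^ 2 := by
      rw [← integral_finsetSum _ fun k _ => iu k, ← integral_const_mul]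
      refine integral_mono iw ((integrable_finsetSum _ fun k _ => iu k).const_mul _) fun x => ?_
      simp only
      rw [← Finset.mul_sum, mul_left_comm]
      exact mul_le_mul_of_nonneg_left (sum_near_sq fun k hk => hus k x hk) (om_pos _ _).le
    calc b ^ 2 * ∫ x, om n b (Real.log ‖x‖) * w x ^ 2
        ≤ b ^ 2 * (5 * ∑ k ∈ Finset.range N, ∫ x, om n b (Real.log ‖x‖) * u k x ^ 2) :=
          mul_le_mul_of_nonneg_left h1 (sq_nonneg _)
      _ = 5 * ∑ k ∈ Finset.range N, b ^ 2 * ∫ x, om n b (Real.log ‖x‖) * u k x ^ 2 := by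
          rw [← Finset.mul_sum]; ring
      _ ≤ 5 * ∑ k ∈ Finset.range N,
            C * ∫ x, om n b (Real.log ‖x‖) * ‖x‖ ^ 2 * ∑ j, F k j x ^ 2 :=
          mul_le_mul_of_nonneg_left (Finset.sum_le_sum fun k _ => hue k) (by norm_num)
      _ ≤ 5 * (C * (5 * I)) := by
          rw [← Finset.mul_sum]
          exact mul_le_mul_of_nonneg_left (mul_le_mul_of_nonneg_left hsumF hC.le) (by norm_num)
      _ ≤ _ := by nlinarith [mul_nonneg hC.le hI0]
  · have iR : ∀ k, Integrable fun x => om n b (Real.log ‖x‖) * ‖x‖ ^ 4 * R k x ^ 2 := fun k =>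
      omr_integrable b 4 (hR k).sq
    have iRt : Integrable fun x => om n b (Real.log ‖x‖) * ‖x‖ ^ 4 * Rt x ^ 2 :=
      omr_integrable b 4 hRA.sq
    have h1 : ∫ x, om n b (Real.log ‖x‖) * ‖x‖ ^ 4 * Rt x ^ 2 ≤
        5 * ∑ k ∈ Finset.range N, ∫ x, om n b (Real.log ‖x‖) * ‖x‖ ^ 4 * R k x ^ 2 := by
      rw [← integral_finsetSum _ fun k _ => iR k, ← integral_const_mul]
      refine integral_mono iRt ((integrable_finsetSum _ fun k _ => iR k).const_mul _) fun x => ?_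
      simp only
      rw [← Finset.mul_sum, mul_left_comm]
      exact mul_le_mul_of_nonneg_left (sum_near_sq fun k hk => hRs k x hk)
        (mul_nonneg (om_pos _ _).le (by positivity))
    have h2 : ∫ x, om n b (Real.log ‖x‖) * ‖x‖ ^ 4 * Rt x ^ 2 ≤ 5 * (C * b ^ 2 * (5 * I)) := by
      refine h1.trans (mul_le_mul_of_nonneg_left ?_ (by norm_num))
      refine (Finset.sum_le_sum fun k _ => hRe k).trans ?_
      rw [← Finset.mul_sum]
      exact mul_le_mul_of_nonneg_left hsumF (by positivity)
    have hsum : ∀ j x, ∑ k ∈ Finset.range N, F k j x = ‖x‖⁻¹ * f j x := fun j x => by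
      by_cases hx : x ∈ tsupport (f j)
      · simp only [hFdef]
        rw [← Finset.sum_mul, ← Finset.sum_mul,
          chi_sum (by linarith [((hf j).supp hx).2]) (hN j x hx), one_mul]
      · simp [hFdef, image_eq_zero_of_notMem_tsupport hx]
    have hid : ∀ x, ‖x‖ ^ 2 * lapl n w x + ‖x‖ * ∑ j, pdir n j (f j) x =
        ‖x‖ ^ 2 * Rt x + ‖x‖⁻¹ * ∑ j, f j x * x j := fun x => by
      by_cases hx : x = 0
      · simp [hx]
      have hx0 : ‖x‖ ≠ 0 := norm_ne_zero_iff.2 hx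
      rw [hw, lapl_sum _ fun k => (hu k).smooth]
      simp only [hlap]
      rw [Finset.sum_sub_distrib, Finset.sum_comm]
      have e1 : ∀ j, ∑ k ∈ Finset.range N, pdir n j (F k j) x =
          ‖x‖⁻¹ * pdir n j (f j) x - ‖x‖⁻¹ ^ 3 * (f j x * x j) := fun j => by
        rw [← pdir_sum _ j fun k _ => (hF k j).diff x]
        have : (fun y => ∑ k ∈ Finset.range N, F k j y) =
          fun y => Real.exp (-Real.log ‖y‖) * f j y := by
          funext y
          rw [hsum]
          by_cases hy : y = 0
          · have : f j y = 0 := (hf j).eq_zero fun h => h.1 hy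
            rw [this]; simp
          · rw [Real.exp_neg, Real.exp_log (norm_pos_iff.2 hy)]
        have hg : HasDerivAt (fun t : ℝ => Real.exp (-t))
            ((fun t => -Real.exp (-t)) (Real.log ‖x‖)) (Real.log ‖x‖) := by
          simpa using (hasDerivAt_neg (Real.log ‖x‖)).exp
        rw [this, pdir_mul (a := fun y : EuclideanSpace ℝ (Fin n) => Real.exp (-Real.log ‖y‖)) j
            (radial_hasFDerivAt (g := fun t : ℝ => Real.exp (-t))
              (g' := fun t : ℝ => -Real.exp (-t)) hx hg).differentiableAt ((hf j).diff x),
          radial_pdir (g := fun t : ℝ => Real.exp (-t)) (g' := fun t : ℝ => -Real.exp (-t)) hx hg j]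
        simp only [Real.exp_neg, Real.exp_log (norm_pos_iff.2 hx)]
        field_simp
        ring
      simp only [e1, Finset.sum_sub_distrib, ← Finset.mul_sum]
      field_simp
      ring
    have hE : ∀ x, (‖x‖ ^ 2 * lapl n w x + ‖x‖ * ∑ j, pdir n j (f j) x) ^ 2 ≤
        2 * (‖x‖ ^ 4 * Rt x ^ 2) + 2 * ∑ j, f j x ^ 2 := fun x => by
      rw [hid]
      have a1 : (‖x‖⁻¹ * ∑ j, f j x * x j) ^ 2 ≤ ∑ j, f j x ^ 2 := by
        have := cauchy_schwarz_sq (fun j => f j x) (fun j => x j)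
        rw [← norm_sq_eq_sum] at this
        have h1 : (‖x‖⁻¹ * ‖x‖) ^ 2 ≤ 1 := by
          by_cases hx : ‖x‖ = 0
          · simp [hx]
          · rw [inv_mul_cancel₀ hx]; norm_num
        calc _ = ‖x‖⁻¹ ^ 2 * (∑ j, f j x * x j) ^ 2 := by ring
          _ ≤ ‖x‖⁻¹ ^ 2 * ((∑ j, f j x ^ 2) * ‖x‖ ^ 2) :=
            mul_le_mul_of_nonneg_left this (sq_nonneg _)
          _ = (‖x‖⁻¹ * ‖x‖) ^ 2 * ∑ j, f j x ^ 2 := by ring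
          _ ≤ _ := mul_le_of_le_one_left (hff0 x) h1
      nlinarith [sq_nonneg (‖x‖ ^ 2 * Rt x - ‖x‖⁻¹ * ∑ j, f j x * x j)]
    have ib : Integrable fun x => 2 * (om n b (Real.log ‖x‖) * ‖x‖ ^ 4 * Rt x ^ 2) +
        2 * (om n b (Real.log ‖x‖) * ∑ j, f j x ^ 2) := (iRt.const_mul 2).add (iff0.const_mul 2)
    have h3 : ∫ x, om n b (Real.log ‖x‖) *
        (‖x‖ ^ 2 * lapl n w x + ‖x‖ * ∑ j, pdir n j (f j) x) ^ 2 ≤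
        ∫ x, (2 * (om n b (Real.log ‖x‖) * ‖x‖ ^ 4 * Rt x ^ 2) +
        2 * (om n b (Real.log ‖x‖) * ∑ j, f j x ^ 2)) := by
      refine integral_mono_of_nonneg (Filter.Eventually.of_forall fun x =>
        mul_nonneg (om_pos _ _).le (sq_nonneg _)) ib (Filter.Eventually.of_forall fun x => ?_)
      simp only
      have := mul_le_mul_of_nonneg_left (hE x) (om_pos (n := n) b (Real.log ‖x‖)).le
      linarith
    rw [integral_add (iRt.const_mul 2) (iff0.const_mul 2), integral_const_mul, integral_const_mul,
      ← hI] at h3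
    refine h3.trans ?_
    have hb2 : I ≤ b ^ 2 * I := le_mul_of_one_le_left hI0 (one_le_pow₀ hb)
    nlinarith

lemma kap_le_om {b t : ℝ} (ht : t < -4) : kap n b t ≤ om n b t := by
  rw [kap]
  refine mul_le_of_le_one_right (om_pos _ _).le ?_
  rw [inv_pow]
  exact inv_le_one_of_one_le₀ (by nlinarith)

lemma kap_int_le {b : ℝ} {v : EuclideanSpace ℝ (Fin n) → ℝ} (hv : Adm n (-4) v)
    (h0 : ∀ x, 0 ≤ v x) : ∫ x, kap n b (Real.log ‖x‖) * v x ≤ ∫ x, om n b (Real.log ‖x‖) * v x := by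
  refine integral_mono (hv.integrable (kap_continuousOn b)) (hv.integrable (om_continuousOn b))
    fun x => ?_
  simp only
  by_cases hx : x ∈ UT n (-4)
  · exact mul_le_mul_of_nonneg_right (kap_le_om hx.2) (h0 x)
  · simp [hv.eq_zero hx]

lemma norm_mul_adm {v : EuclideanSpace ℝ (Fin n) → ℝ} (hv : Adm n T v) :
    Adm n T (fun x => ‖x‖ * v x) :=
  hv.mul_contDiffAt fun _ hx => contDiffAt_norm ℝ hx.1

lemma lapl_sub {v w : EuclideanSpace ℝ (Fin n) → ℝ} (hv : Adm n T v) (hw : Adm n T w)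
    (x : EuclideanSpace ℝ (Fin n)) :
    lapl n (fun y => v y - w y) x = lapl n v x - lapl n w x := by
  simp only [lapl]
  have h1 : ∀ j, pdir n j (fun y => v y - w y) = fun y => pdir n j v y - pdir n j w y :=
    fun j => funext fun y => pdir_sub j (hv.diff y) (hw.diff y)
  rw [← Finset.sum_sub_distrib]
  refine Finset.sum_congr rfl fun j _ => ?_
  rw [h1, pdir_sub j ((hv.pdir j).diff x) ((hw.pdir j).diff x)]

lemma Gadm {w : EuclideanSpace ℝ (Fin n) → ℝ} (hw : Adm n T w)
    {f : Fin n → EuclideanSpace ℝ (Fin n) → ℝ} (hf : ∀ j, Adm n T (f j)) :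
    Adm n T (fun x => ‖x‖ ^ 2 * lapl n w x + ‖x‖ * ∑ j, pdir n j (f j) x) :=
  (hw.lapl.mul_smooth (contDiff_norm_sq ℝ)).add
    (norm_mul_adm (Adm.sum _ fun j _ => (hf j).pdir j))

lemma main_om (n : ℕ) (hn : 2 ≤ n) : ∃ C : ℝ, 0 < C ∧ ∀ b : ℝ, 1 ≤ b →
    ∀ w : EuclideanSpace ℝ (Fin n) → ℝ, Adm n (-6) w →
    ∀ f : Fin n → EuclideanSpace ℝ (Fin n) → ℝ, (∀ j, Adm n (-6) (f j)) →
    (∫ x, kap n b (Real.log ‖x‖) * (‖x‖ ^ 2 * gsq n w x)) +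
      (∫ x, kap n b (Real.log ‖x‖) * w x ^ 2) ≤
    C * ((∫ x, om n b (Real.log ‖x‖) *
      (‖x‖ ^ 2 * lapl n w x + ‖x‖ * ∑ j, pdir n j (f j) x) ^ 2) +
      b * ∫ x, om n b (Real.log ‖x‖) * ∑ j, f j x ^ 2) := by
  obtain ⟨C, hC, H⟩ := div_correct n
  refine ⟨(4 * (n + 5) ^ 2 + 1) * (4 + 6 * C) + 4, by positivity, fun b hb w hw' f hf' => ?_⟩
  obtain ⟨w1, hw1, hL, hE⟩ := H b hb f hf'
  have hw : Adm n (-4) w := hw'.mono (by norm_num)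
  have hf : ∀ j, Adm n (-4) (f j) := fun j => (hf' j).mono (by norm_num)
  have hcac := caccioppoli hb hw hf
  have hG := Gadm hw hf
  have hG1 := Gadm hw1 hf
  have hc := carleman_L2 hb hn (hw.sub hw1)
  have hff0 : ∀ x, 0 ≤ ∑ j, f j x ^ 2 := fun x => Finset.sum_nonneg fun _ _ => sq_nonneg _
  have k1 := kap_int_le (b := b) hG.sq fun x => sq_nonneg _
  have k2 := kap_int_le (b := b) (Adm.sumsq hf) hff0
  have k3 := kap_int_le (b := b) hw1.sq fun x => sq_nonneg _
  have iG := hG.sq.integrable (om_continuousOn (n := n) b)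
  have iE := hG1.sq.integrable (om_continuousOn (n := n) b)
  have hA0 : 0 ≤ ∫ x, om n b (Real.log ‖x‖) *
      (‖x‖ ^ 2 * lapl n w x + ‖x‖ * ∑ j, pdir n j (f j) x) ^ 2 :=
    integral_nonneg fun x => mul_nonneg (om_pos _ _).le (sq_nonneg _)
  have hB0 : 0 ≤ ∫ x, om n b (Real.log ‖x‖) * ∑ j, f j x ^ 2 :=
    integral_nonneg fun x => mul_nonneg (om_pos _ _).le (hff0 x)
  have hX0 : 0 ≤ ∫ x, kap n b (Real.log ‖x‖) * w x ^ 2 :=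
    integral_nonneg fun x => mul_nonneg (kap_nonneg _ _) (sq_nonneg _)
  have h1 : ∫ x, om n b (Real.log ‖x‖) * (‖x‖ ^ 2 * lapl n (fun y => w y - w1 y) x) ^ 2 ≤
      2 * (∫ x, om n b (Real.log ‖x‖) *
        (‖x‖ ^ 2 * lapl n w x + ‖x‖ * ∑ j, pdir n j (f j) x) ^ 2) +
      2 * ∫ x, om n b (Real.log ‖x‖) *
        (‖x‖ ^ 2 * lapl n w1 x + ‖x‖ * ∑ j, pdir n j (f j) x) ^ 2 := by
    rw [← integral_const_mul, ← integral_const_mul, ← integral_add (iG.const_mul 2) (iE.const_mul 2)]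
    refine integral_mono_of_nonneg (Filter.Eventually.of_forall fun x =>
      mul_nonneg (om_pos _ _).le (sq_nonneg _)) ((iG.const_mul 2).add (iE.const_mul 2))
      (Filter.Eventually.of_forall fun x => ?_)
    simp only
    rw [lapl_sub hw hw1]
    have ho := om_pos (n := n) b (Real.log ‖x‖)
    generalize ‖x‖ * ∑ j, pdir n j (f j) x = d
    generalize om n b (Real.log ‖x‖) = o at *
    have : (‖x‖ ^ 2 * (lapl n w x - lapl n w1 x)) ^ 2 ≤
      2 * (‖x‖ ^ 2 * lapl n w x + d) ^ 2 + 2 * (‖x‖ ^ 2 * lapl n w1 x + d) ^ 2 := by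
      nlinarith [sq_nonneg ((‖x‖ ^ 2 * lapl n w x + d) + (‖x‖ ^ 2 * lapl n w1 x + d))]
    nlinarith [mul_le_mul_of_nonneg_left this ho.le]
  have ik1 := (hw.sub hw1).sq.integrable (kap_continuousOn (n := n) b)
  have ik2 := hw1.sq.integrable (kap_continuousOn (n := n) b)
  have h2 : ∫ x, kap n b (Real.log ‖x‖) * w x ^ 2 ≤
      2 * (∫ x, kap n b (Real.log ‖x‖) * (w x - w1 x) ^ 2) +
      2 * ∫ x, kap n b (Real.log ‖x‖) * w1 x ^ 2 := by
    rw [← integral_const_mul, ← integral_const_mul,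
      ← integral_add (ik1.const_mul 2) (ik2.const_mul 2)]
    refine integral_mono_of_nonneg (Filter.Eventually.of_forall fun x =>
      mul_nonneg (kap_nonneg _ _) (sq_nonneg _)) ((ik1.const_mul 2).add (ik2.const_mul 2))
      (Filter.Eventually.of_forall fun x => ?_)
    simp only
    have ho := kap_nonneg (n := n) b (Real.log ‖x‖)
    nlinarith [mul_nonneg ho (sq_nonneg (w x - w1 x - w1 x))]
  have hc' : b ^ 3 * (∫ x, kap n b (Real.log ‖x‖) * (w x - w1 x) ^ 2) ≤ _ := hc.trans h1
  clear hc h1 ik1 ik2 iG iE hG hG1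
  generalize (∫ x, om n b (Real.log ‖x‖) *
        (‖x‖ ^ 2 * lapl n w1 x + ‖x‖ * ∑ j, pdir n j (f j) x) ^ 2) = E at *
  generalize (∫ x, om n b (Real.log ‖x‖) *
        (‖x‖ ^ 2 * lapl n w x + ‖x‖ * ∑ j, pdir n j (f j) x) ^ 2) = A at *
  generalize (∫ x, om n b (Real.log ‖x‖) * ∑ j, f j x ^ 2) = B at *
  generalize (∫ x, kap n b (Real.log ‖x‖) * w x ^ 2) = X at *
  generalize (∫ x, kap n b (Real.log ‖x‖) * (w x - w1 x) ^ 2) = Y at *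
  generalize (∫ x, kap n b (Real.log ‖x‖) * w1 x ^ 2) = V at *
  generalize (∫ x, om n b (Real.log ‖x‖) * w1 x ^ 2) = V' at *
  generalize (∫ x, kap n b (Real.log ‖x‖) * (‖x‖ ^ 2 * gsq n w x)) = Q at *
  generalize (∫ x, kap n b (Real.log ‖x‖) * ∑ j, f j x ^ 2) = B' at *
  generalize (∫ x, kap n b (Real.log ‖x‖) *
        (‖x‖ ^ 2 * lapl n w x + ‖x‖ * ∑ j, pdir n j (f j) x) ^ 2) = A' at *
  have hb0 : 0 < b := by linarith
  have hAb : A ≤ b * A := le_mul_of_one_le_left hA0 hb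
  have hBb : B ≤ b * B := le_mul_of_one_le_left hB0 hb
  have hY : b ^ 2 * Y ≤ 2 * A + 2 * C * (b * B) := by
    refine le_of_mul_le_mul_left ?_ hb0
    calc b * (b ^ 2 * Y) = b ^ 3 * Y := by ring
      _ ≤ 2 * A + 2 * (C * b ^ 2 * B) := by linarith
      _ ≤ b * (2 * A + 2 * C * (b * B)) := by
        have : b * (2 * A + 2 * C * (b * B)) = 2 * (b * A) + 2 * (C * b ^ 2 * B) := by ring
        linarith
  have hX : b ^ 2 * X ≤ (4 + 6 * C) * (A + b * B) := by
    have e1 : b ^ 2 * X ≤ b ^ 2 * (2 * Y + 2 * V') :=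
      mul_le_mul_of_nonneg_left (by linarith) (sq_nonneg b)
    have e2 : C * B ≤ C * (b * B) := mul_le_mul_of_nonneg_left hBb hC.le
    have e3 : 0 ≤ C * A := mul_nonneg hC.le hA0
    have e4 : 0 ≤ b * B := mul_nonneg hb0.le hB0
    nlinarith
  have hXX : X ≤ b ^ 2 * X := le_mul_of_one_le_left hX0 (one_le_pow₀ hb)
  have e5 : 4 * ((n + 5) * b) ^ 2 * X = 4 * ((n : ℝ) + 5) ^ 2 * (b ^ 2 * X) := by ring
  have e6 : 4 * ((n : ℝ) + 5) ^ 2 * (b ^ 2 * X) ≤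
      4 * ((n : ℝ) + 5) ^ 2 * ((4 + 6 * C) * (A + b * B)) :=
    mul_le_mul_of_nonneg_left hX (by positivity)
  have e4 : 0 ≤ b * B := mul_nonneg hb0.le hB0
  rw [e5] at hcac
  calc Q + X ≤ 4 * ((n : ℝ) + 5) ^ 2 * ((4 + 6 * C) * (A + b * B)) + A + 3 * B +
        (4 + 6 * C) * (A + b * B) := by linarith
    _ ≤ 4 * ((n : ℝ) + 5) ^ 2 * ((4 + 6 * C) * (A + b * B)) + 4 * (A + b * B) +
        (4 + 6 * C) * (A + b * B) := by linarith
    _ = _ := by ring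

lemma wt_eq {x : EuclideanSpace ℝ (Fin n)} (hx : x ∈ UT n (-4)) (β : ℝ) :
    (carlemanWt β ‖x‖) ^ 2 * (Real.log ‖x‖) ^ 4 * ‖x‖ ^ ((2 : ℝ) - n) =
      om n (β - 1) (Real.log ‖x‖) := by
  have hx0 : 0 < ‖x‖ := norm_pos_iff.2 hx.1
  rw [Real.rpow_def_of_pos hx0, carlemanWt, om, psi, ← Real.exp_nat_mul]
  have ht := hx.2
  generalize Real.log ‖x‖ = t at *
  have h4 : t ^ 4 = Real.exp (2 * Real.log (t ^ 2)) := by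
    have : 0 < t ^ 2 := by nlinarith
    rw [two_mul, Real.exp_add, Real.exp_log this]; ring
  rw [h4, ← Real.exp_add, ← Real.exp_add]
  congr 1
  push_cast
  ring

lemma wt_eq2 {x : EuclideanSpace ℝ (Fin n)} (hx : x ∈ UT n (-4)) (β : ℝ) :
    (carlemanWt β ‖x‖) ^ 2 * (Real.log ‖x‖) ^ 2 * ‖x‖ ^ ((2 : ℝ) - n) =
      kap n (β - 1) (Real.log ‖x‖) := by
  rw [kap, ← wt_eq hx]
  have h0 : Real.log ‖x‖ ≠ 0 := by linarith [hx.2]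
  field_simp

lemma adm_of {v : EuclideanSpace ℝ (Fin n) → ℝ} (h1 : ContDiff ℝ (⊤ : ℕ∞) v)
    (h2 : HasCompactSupport v)
    (h3 : tsupport v ⊆ Metric.ball (0 : EuclideanSpace ℝ (Fin n)) (Real.exp (-6)))
    (h4 : (0 : EuclideanSpace ℝ (Fin n)) ∉ tsupport v) : Adm n (-6) v := by
  refine ⟨h1, h2, fun x hx => ?_⟩
  have hx0 : x ≠ 0 := fun h => h4 (h ▸ hx)
  refine ⟨hx0, ?_⟩
  have : ‖x‖ < Real.exp (-6) := by simpa using h3 hx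
  rwa [Real.log_lt_iff_lt_exp (norm_pos_iff.2 hx0)]


end Helpers

/-- **Lemma 2.4 (Carleman estimate with divergence term).** There exist `r₁ > 0`
small, `β₁ > 3` large and `C > 0`, all depending only on `n`, such that for every
scalar `w ∈ C₀^∞(ℝⁿ \ {0})` and vector field `f = (f₁,…,fₙ)` with components in
`C₀^∞(ℝⁿ \ {0})`, all supported in `B_{r₁}`, and every `β ≥ β₁`:
`∫ φ_β² (log|x|)² (|x|^{4-n}|∇w|² + |x|^{2-n}|w|²)
  ≤ C ∫ φ_β² (log|x|)⁴ |x|^{2-n} [(|x|²Δw + |x| div f)² + β‖f‖²]`. -/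
theorem carleman_estimate_div (n : ℕ) (hn : 2 ≤ n) :
    ∃ r₁ : ℝ, 0 < r₁ ∧ ∃ β₁ : ℝ, 3 < β₁ ∧ ∃ C : ℝ, 0 < C ∧
      ∀ w : EuclideanSpace ℝ (Fin n) → ℝ,
        ContDiff ℝ (⊤ : ℕ∞) w → HasCompactSupport w →
        tsupport w ⊆ Metric.ball (0 : EuclideanSpace ℝ (Fin n)) r₁ →
        (0 : EuclideanSpace ℝ (Fin n)) ∉ tsupport w →
      ∀ f : Fin n → EuclideanSpace ℝ (Fin n) → ℝ,
        (∀ j, ContDiff ℝ (⊤ : ℕ∞) (f j) ∧ HasCompactSupport (f j) ∧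
          tsupport (f j) ⊆ Metric.ball (0 : EuclideanSpace ℝ (Fin n)) r₁ ∧
          (0 : EuclideanSpace ℝ (Fin n)) ∉ tsupport (f j)) →
      ∀ β : ℝ, β₁ ≤ β →
        (∫ x : EuclideanSpace ℝ (Fin n),
            (carlemanWt β ‖x‖) ^ 2 * (Real.log ‖x‖) ^ 2 *
              (‖x‖ ^ ((4 : ℝ) - n) * ‖fderiv ℝ w x‖ ^ 2 +
               ‖x‖ ^ ((2 : ℝ) - n) * (w x) ^ 2)) ≤
        C * ∫ x : EuclideanSpace ℝ (Fin n),
            (carlemanWt β ‖x‖) ^ 2 * (Real.log ‖x‖) ^ 4 * ‖x‖ ^ ((2 : ℝ) - n) *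
              ((‖x‖ ^ 2 * lapl n w x + ‖x‖ * ∑ j, pdir n j (f j) x) ^ 2 +
                β * ∑ j, (f j x) ^ 2) := by
  obtain ⟨C, hC, H⟩ := main_om n hn
  refine ⟨Real.exp (-6), Real.exp_pos _, 4, by norm_num, C, hC, ?_⟩
  intro w w1 w2 w3 w4 f hf β hβ
  have hw6 : Adm n (-6) w := adm_of w1 w2 w3 w4
  have hf6 : ∀ j, Adm n (-6) (f j) := fun j =>
    adm_of (hf j).1 (hf j).2.1 (hf j).2.2.1 (hf j).2.2.2
  have hw : Adm n (-4) w := hw6.mono (by norm_num)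
  have hf4 : ∀ j, Adm n (-4) (f j) := fun j => (hf6 j).mono (by norm_num)
  have key := H (β - 1) (by linarith) w hw6 f hf6
  have hG := Gadm hw hf4
  have hff := Adm.sumsq hf4
  have hff0 : ∀ x, 0 ≤ ∑ j, f j x ^ 2 := fun x => Finset.sum_nonneg fun _ _ => sq_nonneg _
  have iG := hG.sq.integrable (om_continuousOn (n := n) (β - 1))
  have iF := hff.integrable (om_continuousOn (n := n) (β - 1))
  have ig := (hw.gsq.mul_smooth (contDiff_norm_sq ℝ)).integrable (kap_continuousOn (n := n) (β - 1))
  have iw := hw.sq.integrable (kap_continuousOn (n := n) (β - 1))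
  have eR : ∀ x : EuclideanSpace ℝ (Fin n),
      (carlemanWt β ‖x‖) ^ 2 * (Real.log ‖x‖) ^ 4 * ‖x‖ ^ ((2 : ℝ) - n) *
              ((‖x‖ ^ 2 * lapl n w x + ‖x‖ * ∑ j, pdir n j (f j) x) ^ 2 +
                β * ∑ j, (f j x) ^ 2) =
      om n (β - 1) (Real.log ‖x‖) * (‖x‖ ^ 2 * lapl n w x + ‖x‖ * ∑ j, pdir n j (f j) x) ^ 2 +
      β * (om n (β - 1) (Real.log ‖x‖) * ∑ j, f j x ^ 2) := fun x => by
    by_cases hx : x ∈ UT n (-4)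
    · rw [wt_eq hx]; ring
    · have z1 := hG.eq_zero hx
      have z2 := hff.eq_zero hx
      rw [z1, z2]; simp
  have eL : ∀ x : EuclideanSpace ℝ (Fin n),
      (carlemanWt β ‖x‖) ^ 2 * (Real.log ‖x‖) ^ 2 *
              (‖x‖ ^ ((4 : ℝ) - n) * ‖fderiv ℝ w x‖ ^ 2 +
               ‖x‖ ^ ((2 : ℝ) - n) * (w x) ^ 2) ≤
      kap n (β - 1) (Real.log ‖x‖) * (‖x‖ ^ 2 * gsq n w x) +
        kap n (β - 1) (Real.log ‖x‖) * w x ^ 2 := fun x => by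
    have hgr : ‖fderiv ℝ w x‖ ^ 2 ≤ gsq n w x := fderiv_norm_sq_le w x
    by_cases hx : x ∈ UT n (-4)
    · have hx0 : 0 < ‖x‖ := norm_pos_iff.2 hx.1
      have e4 : ‖x‖ ^ ((4 : ℝ) - n) = ‖x‖ ^ ((2 : ℝ) - n) * ‖x‖ ^ 2 := by
        rw [← Real.rpow_natCast, ← Real.rpow_add hx0]
        congr 1; push_cast; ring
      have : (carlemanWt β ‖x‖) ^ 2 * (Real.log ‖x‖) ^ 2 *
              (‖x‖ ^ ((4 : ℝ) - n) * ‖fderiv ℝ w x‖ ^ 2 +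
               ‖x‖ ^ ((2 : ℝ) - n) * (w x) ^ 2) =
          kap n (β - 1) (Real.log ‖x‖) * (‖x‖ ^ 2 * ‖fderiv ℝ w x‖ ^ 2) +
          kap n (β - 1) (Real.log ‖x‖) * w x ^ 2 := by
        rw [← wt_eq2 hx, e4]; ring
      rw [this]
      have := mul_le_mul_of_nonneg_left (mul_le_mul_of_nonneg_left hgr (sq_nonneg ‖x‖))
        (kap_nonneg (n := n) (β - 1) (Real.log ‖x‖))
      linarith
    · have z1 := hw.gsq.eq_zero hx
      have z2 := hw.eq_zero hx
      have z3 : ‖fderiv ℝ w x‖ ^ 2 = 0 := le_antisymm (z1 ▸ hgr) (sq_nonneg _)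
      rw [z1, z2, z3]; simp
  have hB0 : 0 ≤ ∫ x, om n (β - 1) (Real.log ‖x‖) * ∑ j, f j x ^ 2 :=
    integral_nonneg fun x => mul_nonneg (om_pos _ _).le (hff0 x)
  simp only [eR]
  rw [integral_add iG (iF.const_mul β), integral_const_mul]
  refine (integral_mono_of_nonneg (Filter.Eventually.of_forall fun x => ?_) (ig.add iw)
    (Filter.Eventually.of_forall eL)).trans ?_
  · simp only [Pi.zero_apply]
    positivity
  · refine (le_of_eq (integral_add ig iw)).trans (key.trans ?_)
    refine mul_le_mul_of_nonneg_left ?_ hC.le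
    nlinarith
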